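/- arXiv:2205.06147 — 4 statements merged into one kernel-verified Lean document; each statement's English description precedes it below -/
import Mathlib

section
/- If f is a nonzero polynomial over a field F with k(f) = 1 (i.e. f is divisible by t but not t²), then the matrix f(J_{0,m}) is similar to J_{0,m}. -/
/-- The nilpotent Jordan block of size `m`. -/
def jordanBlock (F : Type*) [Field F] (m : ℕ) : Matrix (Fin m) (Fin m) F :=
  Matrix.of fun i j => if (j : ℕ) = (i : ℕ) + 1 then 1 else 0

open Polynomial in
theorem Polynomial.coeff_pow_eq_zero_of_X_dvd {R : Type*} [CommRing R] {f : R[X]} (h : X ∣ f)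
    {k n : ℕ} (hn : n < k) : (f ^ k).coeff n = 0 :=
  X_pow_dvd_iff.1 (pow_dvd_pow_of_dvd h k) n hn

open Polynomial in
theorem Polynomial.coeff_pow_self_of_X_dvd {R : Type*} [CommRing R] {f : R[X]} (h : X ∣ f)
    (k : ℕ) : (f ^ k).coeff k = f.coeff 1 ^ k := by
  obtain ⟨q, rfl⟩ := h
  rw [mul_pow, coeff_X_pow_mul', if_pos le_rfl, Nat.sub_self, coeff_zero_eq_eval_zero, eval_pow,
    ← coeff_zero_eq_eval_zero, coeff_X_mul]

theorem mul_jordanBlock_apply_zero {F : Type*} [Field F] {m : ℕ}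
    (A : Matrix (Fin m) (Fin m) F) (i j : Fin m) (hj : (j : ℕ) = 0) :
    (A * jordanBlock F m) i j = 0 := by
  simp [Matrix.mul_apply, jordanBlock, hj]

theorem mul_jordanBlock_apply_succ {F : Type*} [Field F] {m : ℕ}
    (A : Matrix (Fin m) (Fin m) F) (i j l : Fin m) (hj : (j : ℕ) = l + 1) :
    (A * jordanBlock F m) i j = A i l := by
  simp [Matrix.mul_apply, jordanBlock, hj, ← Fin.ext_iff]

theorem jordanBlock_pow_apply (F : Type*) [Field F] (m k : ℕ) (i j : Fin m) :
    (jordanBlock F m ^ k) i j = if (j : ℕ) = i + k then 1 else 0 := by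
  induction k generalizing j with
  | zero => simp [Matrix.one_apply, Fin.ext_iff, eq_comm]
  | succ k ih =>
    rw [pow_succ]
    by_cases hj : (j : ℕ) = 0
    · rw [mul_jordanBlock_apply_zero _ _ _ hj, if_neg (by omega)]
    · rw [mul_jordanBlock_apply_succ _ i j ⟨j - 1, by omega⟩ (by simp; omega), ih]
      congr 1
      simp only [eq_iff_iff]
      omega

theorem aeval_jordanBlock_apply {F : Type*} [Field F] {m : ℕ} (p : Polynomial F) (i j : Fin m) :
    Polynomial.aeval (jordanBlock F m) p i j = if i ≤ j then p.coeff (j - i) else 0 := by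
  induction p using Polynomial.induction_on' with
  | add p q hp hq =>
    rw [map_add, Matrix.add_apply, hp, hq]
    split_ifs <;> simp
  | monomial n a =>
    rw [Polynomial.aeval_monomial, ← Algebra.smul_def, Matrix.smul_apply, jordanBlock_pow_apply,
      Polynomial.coeff_monomial, smul_eq_mul]
    simp only [Fin.le_def]
    split_ifs <;> first | omega | simp

/-- If `f ≠ 0` and `k(f) = 1` (i.e. `t ∣ f` but `t² ∤ f`), then `f(J_{0,m})`
is similar to `J_{0,m}`. -/
theorem stmt3 (F : Type*) [Field F] (m : ℕ) (hm : 0 < m)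
    (f : Polynomial F) (hf : f ≠ 0) (h1 : f.rootMultiplicity 0 = 1) :
    ∃ g : (Matrix (Fin m) (Fin m) F)ˣ,
      Polynomial.aeval (jordanBlock F m) f =
        (g : Matrix (Fin m) (Fin m) F) * jordanBlock F m *
          ((g⁻¹ : (Matrix (Fin m) (Fin m) F)ˣ) : Matrix (Fin m) (Fin m) F) := by
  have hX : Polynomial.X ∣ f := by
    simpa [h1] using Polynomial.pow_rootMultiplicity_dvd f 0
  have hc : f.coeff 1 ≠ 0 := by
    intro hc
    have h2 : (Polynomial.X - Polynomial.C 0) ^ 2 ∣ f := by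
      rw [Polynomial.C_0, sub_zero, Polynomial.X_pow_dvd_iff]
      intro d hd
      interval_cases d
      · exact Polynomial.X_dvd_iff.1 hX
      · exact hc
    have := (Polynomial.le_rootMultiplicity_iff hf).2 h2
    omega
  let last : Fin m := ⟨m - 1, by omega⟩
  -- The columns of `G` form the Jordan chain of `f(J)` generated by the last basis vector.
  let G : Matrix (Fin m) (Fin m) F := Matrix.of fun i j =>
    Polynomial.aeval (jordanBlock F m) (f ^ (m - 1 - j)) i last
  have hG (i j : Fin m) : G i j = (f ^ (m - 1 - j)).coeff (m - 1 - i) := by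
    simp only [G, Matrix.of_apply, aeval_jordanBlock_apply]
    rw [if_pos (by simp only [Fin.le_def, last]; omega)]
  have hdet : IsUnit G.det := by
    rw [Matrix.det_of_isUpperTriangular]
    · rw [isUnit_iff_ne_zero, Finset.prod_ne_zero_iff]
      intro i _
      rw [hG, Polynomial.coeff_pow_self_of_X_dvd hX]
      exact pow_ne_zero _ hc
    · intro i j hij
      have hij' : (j : ℕ) < i := hij
      rw [hG]
      exact Polynomial.coeff_pow_eq_zero_of_X_dvd hX (by omega)
  obtain ⟨g, hg⟩ := (Matrix.isUnit_iff_isUnit_det G).2 hdet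
  refine ⟨g, ?_⟩
  rw [Units.eq_mul_inv_iff_mul_eq, hg]
  ext i j
  have hAG : (Polynomial.aeval (jordanBlock F m) f * G) i j =
      (f ^ (m - 1 - j + 1)).coeff (m - 1 - i) := by
    have : (Polynomial.aeval (jordanBlock F m) f * G) i j =
        Polynomial.aeval (jordanBlock F m) (f ^ (m - 1 - j + 1)) i last := by
      rw [pow_succ', map_mul, Matrix.mul_apply, Matrix.mul_apply]
      rfl
    rw [this, aeval_jordanBlock_apply, if_pos (by simp only [Fin.le_def, last]; omega)]
  rw [hAG]
  by_cases hj : (j : ℕ) = 0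
  · rw [mul_jordanBlock_apply_zero _ _ _ hj]
    exact Polynomial.coeff_pow_eq_zero_of_X_dvd hX (by omega)
  · rw [mul_jordanBlock_apply_succ _ i j ⟨j - 1, by omega⟩ (by simp; omega), hG]
    congr 2
    simp only
    omega
end

section
/- Let X, Y be commuting nilpotent endomorphisms of an n-dimensional vector space over an algebraically closed field, with m := h(X) ≥ n/2 + 1 and l := h(Y) > n − m + 2. Then l = ⌈m/p⌉ for some positive integer p. -/
/-- Nakayama's lemma for a nilpotent ideal. -/
theorem Submodule.le_of_le_sup_smul_of_pow_eq_bot {R V : Type*} [CommRing R] [AddCommGroup V]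
    [Module R V] {I : Ideal R} {k : ℕ} (hI : I ^ k = ⊥) {P Q : Submodule R V}
    (h : P ≤ Q ⊔ I • P) : P ≤ Q := by
  have key : ∀ i : ℕ, P ≤ Q ⊔ I ^ i • P := by
    intro i
    induction i with
    | zero => simp
    | succ i ih =>
      refine ih.trans (sup_le le_sup_left ?_)
      calc I ^ i • P ≤ I ^ i • (Q ⊔ I • P) := Submodule.smul_mono le_rfl h
        _ = I ^ i • Q ⊔ I ^ (i + 1) • P := by
          rw [Submodule.smul_sup, ← Submodule.mul_smul, pow_succ]
        _ ≤ _ := sup_le_sup_right Submodule.smul_le_right _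
  simpa [hI] using key k

theorem Ideal.exists_span_pair_pow_eq_bot {R : Type*} [CommRing R] {x y : R}
    (hx : IsNilpotent x) (hy : IsNilpotent y) : ∃ k, (Ideal.span {x, y}) ^ k = ⊥ := by
  have hle : Ideal.span {x, y} ≤ nilradical R := by
    rw [Ideal.span_le]
    rintro z (rfl | rfl)
    · exact hx
    · exact hy
  have hfg : (Ideal.span {x, y}).FG := Submodule.fg_span (Set.toFinite _)
  obtain ⟨k, hk⟩ := Ideal.exists_pow_le_of_le_radical_of_fg (I := Ideal.span {x, y})
    (J := ⊥) hle hfg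
  exact ⟨k, le_bot_iff.mp hk⟩

theorem Submodule.pow_smul_le_of_finrank_le {F R V : Type*} [Field F] [CommRing R] [Algebra F R]
    [AddCommGroup V] [Module F V] [Module R V] [IsScalarTower F R V] [FiniteDimensional F V]
    {I : Ideal R} {k : ℕ} (hI : I ^ k = ⊥) (d : ℕ) {N U : Submodule R V} (hNU : N ≤ U)
    (hd : Module.finrank F (U.restrictScalars F) ≤ Module.finrank F (N.restrictScalars F) + d) :
    I ^ d • U ≤ N := by
  induction d generalizing U with
  | zero =>
    have := Submodule.eq_of_le_of_finrank_le
      (show N.restrictScalars F ≤ U.restrictScalars F from hNU) (by simpa using hd)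
    rw [Submodule.restrictScalars_inj] at this
    simp [this]
  | succ d ih =>
    by_cases hU : U ≤ N
    · exact Submodule.smul_le_right.trans hU
    have hlt : N ⊔ I • U < U := by
      refine lt_of_le_of_ne (sup_le hNU Submodule.smul_le_right) fun h => hU ?_
      exact Submodule.le_of_le_sup_smul_of_pow_eq_bot hI h.ge
    have hlt' := Submodule.finrank_lt_finrank_of_lt
      (show (N ⊔ I • U).restrictScalars F < U.restrictScalars F from hlt)
    rw [pow_succ, Submodule.mul_smul]
    exact (Submodule.smul_mono le_rfl le_sup_right).trans (ih le_sup_left (by omega))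

theorem Ideal.pow_eq_span_singleton_pow {R : Type*} [CommRing R] {x y : R} {k : ℕ}
    (hk : (Ideal.span {x, y}) ^ k = ⊥) {j : ℕ}
    (hj : ∀ J : Ideal R, (Ideal.span {x, y}) ^ (j + 1) ≤ J → J ≤ (Ideal.span {x, y}) ^ j →
      J = (Ideal.span {x, y}) ^ (j + 1) ∨ J = (Ideal.span {x, y}) ^ j)
    (hx : ¬ Ideal.span {x} * (Ideal.span {x, y}) ^ j ≤ (Ideal.span {x, y}) ^ (j + 2)) :
    (Ideal.span {x, y}) ^ j = Ideal.span {x ^ j} := by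
  set M : Ideal R := Ideal.span {x, y}
  have hxM : Ideal.span {x} ≤ M := Ideal.span_mono (by simp)
  have key : ∀ i ≤ j, M ^ j = Ideal.span {x} ^ i * M ^ (j - i) ⊔ M ^ (j + 1) := by
    intro i
    induction i with
    | zero =>
      intro _
      simpa using Ideal.pow_le_pow_right (Nat.le_succ j)
    | succ i ih =>
      intro hi
      have hle : Ideal.span {x} ^ (i + 1) * M ^ (j - (i + 1)) ≤ M ^ j := by
        calc _ ≤ M ^ (i + 1) * M ^ (j - (i + 1)) := Ideal.mul_mono_left (Ideal.pow_right_mono hxM _)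
          _ = M ^ j := by rw [← pow_add]; congr 1; omega
      rcases hj (Ideal.span {x} ^ (i + 1) * M ^ (j - (i + 1)) ⊔ M ^ (j + 1)) le_sup_right
        (sup_le hle (Ideal.pow_le_pow_right (Nat.le_succ j))) with h | h
      · refine absurd ?_ hx
        have h1 : Ideal.span {x} ^ (i + 1) * M ^ (j - (i + 1)) ≤ M ^ (j + 1) := by
          rw [← h]; exact le_sup_left
        rw [ih (by omega), Ideal.mul_sup]
        refine sup_le ?_ ?_
        · calc Ideal.span {x} * (Ideal.span {x} ^ i * M ^ (j - i))
              = M * (Ideal.span {x} ^ (i + 1) * M ^ (j - (i + 1))) := by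
                rw [show j - i = j - (i + 1) + 1 by omega]; ring
            _ ≤ M * M ^ (j + 1) := Ideal.mul_mono_right h1
            _ = M ^ (j + 2) := by ring
        · calc Ideal.span {x} * M ^ (j + 1) ≤ M * M ^ (j + 1) := Ideal.mul_mono_left hxM
            _ = M ^ (j + 2) := by ring
      · exact h.symm
  have h := key j le_rfl
  rw [Nat.sub_self, pow_zero, mul_one, Ideal.span_singleton_pow] at h
  refine le_antisymm ?_ (le_sup_left.trans h.ge)
  refine Submodule.le_of_le_sup_smul_of_pow_eq_bot hk ?_
  rw [smul_eq_mul, ← pow_succ']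
  exact h.le

theorem Ideal.pow_add_eq_span_singleton_pow {R : Type*} [CommRing R] {M : Ideal R} {z : R}
    (hz : z ∈ M) {j : ℕ} (hj : 1 ≤ j) (h : M ^ j = Ideal.span {z ^ j}) (i : ℕ) :
    M ^ (j + i) = Ideal.span {z ^ (j + i)} := by
  induction i with
  | zero => exact h
  | succ i ih =>
    refine le_antisymm ?_ ?_
    · obtain ⟨t, ht⟩ : ∃ t, j + i = t + 1 := ⟨j + i - 1, by omega⟩
      calc M ^ (j + (i + 1)) = M * M ^ (j + i) := by ring
        _ = M * Ideal.span {z ^ t} * Ideal.span {z} := by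
          rw [ih, ht, mul_assoc, Ideal.span_singleton_mul_span_singleton, pow_succ]
        _ ≤ M * M ^ t * Ideal.span {z} := by
          refine Ideal.mul_mono_left (Ideal.mul_mono_right ?_)
          rw [Ideal.span_singleton_le_iff_mem]
          exact Ideal.pow_mem_pow hz t
        _ = M ^ (j + i) * Ideal.span {z} := by rw [ht]; ring
        _ = _ := by
          rw [ih, Ideal.span_singleton_mul_span_singleton, ← pow_succ, add_assoc]
    · rw [Ideal.span_singleton_le_iff_mem]
      exact Ideal.pow_mem_pow hz _

/-- If `B` has dimension at most `2m - 2` and `x` has nilpotency index `m`, then every product of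
`m` factors from the nilpotent ideal `(x, y)` vanishes. -/
theorem Ideal.span_pair_pow_eq_bot {F B : Type*} [Field F] [CommRing B] [Algebra F B]
    [FiniteDimensional F B] {x y : B} {m : ℕ} (hx : x ^ m = 0) (hx' : x ^ (m - 1) ≠ 0)
    (hy : IsNilpotent y) (hd : Module.finrank F B + 2 ≤ 2 * m) :
    (Ideal.span {x, y}) ^ m = ⊥ := by
  by_contra hne
  obtain ⟨k, hk⟩ := Ideal.exists_span_pair_pow_eq_bot ⟨m, hx⟩ hy
  have hxM : Ideal.span {x} ≤ Ideal.span {x, y} := Ideal.span_mono (by simp)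
  have hsup : Ideal.span {x} ⊔ Ideal.span {y} = Ideal.span {x, y} := by
    rw [← Ideal.span_union]; rfl
  have hswap : Ideal.span {x, y} = Ideal.span {y, x} := by rw [Set.pair_comm]
  set M : Ideal B := Ideal.span {x, y}
  have hmem : x ∈ M := Ideal.subset_span (by simp)
  have hmemy : y ∈ M := Ideal.subset_span (by simp)
  have hstrict : ∀ i ≤ m, M ^ (i + 1) < M ^ i := by
    intro i hi
    refine lt_of_le_of_ne (Ideal.pow_le_pow_right (Nat.le_succ i)) fun h => hne ?_
    have h0 : M ^ i ≤ ⊥ := Submodule.le_of_le_sup_smul_of_pow_eq_bot hk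
      (by rw [smul_eq_mul, ← pow_succ', h, bot_sup_eq])
    exact le_bot_iff.mp ((Ideal.pow_le_pow_right hi).trans h0)
  have hfr : ∀ i ≤ m, Module.finrank F ((M ^ (i + 1)).restrictScalars F) <
      Module.finrank F ((M ^ i).restrictScalars F) := fun i hi =>
    Submodule.finrank_lt_finrank_of_lt
      (show (M ^ (i + 1)).restrictScalars F < (M ^ i).restrictScalars F from hstrict i hi)
  have htop : Module.finrank F ((M ^ 0).restrictScalars F) ≤ Module.finrank F B :=
    Submodule.finrank_le _
  obtain ⟨j, hj1, hjm, hj⟩ : ∃ j, 1 ≤ j ∧ j + 2 ≤ m ∧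
      Module.finrank F ((M ^ j).restrictScalars F) ≤
        Module.finrank F ((M ^ (j + 1)).restrictScalars F) + 1 := by
    by_contra! hcon
    have h2 : ∀ i, i + 2 ≤ m → Module.finrank F ((M ^ (i + 1)).restrictScalars F) + 2 * i ≤
        Module.finrank F ((M ^ 1).restrictScalars F) := by
      intro i
      induction i with
      | zero => simp
      | succ i ih =>
        intro hi
        have := ih (by omega)
        have := hcon (i + 1) (by omega) (by omega)
        omega
    have h3 := hfr 0 (by omega)
    rw [zero_add] at h3
    have h4 := hfr m le_rfl
    rcases Nat.lt_or_ge m 2 with hm | hm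
    · omega
    have h5 := h2 (m - 2) (by omega)
    have h6 := hfr (m - 1) (by omega)
    rw [show m - 2 + 1 = m - 1 by omega] at h5
    rw [show m - 1 + 1 = m by omega] at h6
    omega
  have hcover : ∀ J : Ideal B, M ^ (j + 1) ≤ J → J ≤ M ^ j → J = M ^ (j + 1) ∨ J = M ^ j := by
    intro J h1 h2
    by_contra! hcon
    have hl := Submodule.finrank_lt_finrank_of_lt
      (show (M ^ (j + 1)).restrictScalars F < J.restrictScalars F from
        (lt_of_le_of_ne h1 hcon.1.symm : M ^ (j + 1) < J))
    have hr := Submodule.finrank_lt_finrank_of_lt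
      (show J.restrictScalars F < (M ^ j).restrictScalars F from
        (lt_of_le_of_ne h2 hcon.2 : J < M ^ j))
    omega
  by_cases hxj : Ideal.span {x} * M ^ j ≤ M ^ (j + 2)
  · have hyj : ¬ Ideal.span {y} * M ^ j ≤ M ^ (j + 2) := fun h =>
      (hstrict (j + 1) (by omega)).not_ge <| by
        rw [pow_succ' M j]
        nth_rewrite 1 [← hsup]
        rw [Ideal.sup_mul]
        exact sup_le hxj h
    have hyspan : M ^ j = Ideal.span {y ^ j} := by
      rw [hswap] at hyj hcover hk ⊢
      exact Ideal.pow_eq_span_singleton_pow hk hcover hyj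
    obtain ⟨q, hq, hqe⟩ : ∃ q ∈ M ^ 2, q * y ^ j = x * y ^ j := by
      rw [← Ideal.mem_mul_span_singleton, ← hyspan, ← pow_add, add_comm]
      exact hxj (Ideal.mul_mem_mul (Ideal.mem_span_singleton_self x) (Ideal.pow_mem_pow hmemy j))
    have hann : ∀ p ∈ M ^ j, p * (x - q) = 0 := by
      intro p hp
      rw [hyspan, Ideal.mem_span_singleton'] at hp
      obtain ⟨c, rfl⟩ := hp
      rw [mul_assoc, mul_sub, mul_comm (y ^ j) x, mul_comm (y ^ j) q, hqe, sub_self, mul_zero]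
    have hqM : q ∈ M := Ideal.pow_le_self (by norm_num) hq
    have hsum : ∑ i ∈ Finset.range (m - 1), x ^ i * q ^ (m - 1 - 1 - i) ∈ M ^ j := by
      refine Ideal.sum_mem _ fun i hi => ?_
      have hi := Finset.mem_range.mp hi
      refine Ideal.pow_le_pow_right (show j ≤ i + (m - 1 - 1 - i) by omega) ?_
      rw [pow_add]
      exact Ideal.mul_mem_mul (Ideal.pow_mem_pow hmem _) (Ideal.pow_mem_pow hqM _)
    have hdiff := (Commute.all x q).geom_sum₂_mul (m - 1)
    rw [hann _ hsum] at hdiff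
    have hbot : M ^ (2 * (m - 1)) = ⊥ := by
      have h := Submodule.pow_smul_le_of_finrank_le (F := F) hk (2 * (m - 1))
        (bot_le : ⊥ ≤ (⊤ : Ideal B)) ?_
      · simpa using h
      · exact (Submodule.finrank_le _).trans (by omega)
    have hq0 : q ^ (m - 1) = 0 := by
      have := Ideal.pow_mem_pow hq (m - 1)
      rwa [← pow_mul, hbot, Submodule.mem_bot] at this
    rw [hq0, sub_zero] at hdiff
    exact hx' hdiff.symm
  · have h := Ideal.pow_add_eq_span_singleton_pow hmem hj1
      (Ideal.pow_eq_span_singleton_pow hk hcover hxj) (m - j)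
    rw [show j + (m - j) = m by omega, hx] at h
    exact hne (by simpa using h)

theorem Polynomial.aeval_eq_pow_mul_unit_of_isNilpotent {F B : Type*} [Field F] [CommRing B]
    [Algebra F B] {x : B} (hx : IsNilpotent x) {f : Polynomial F} (hf : f ≠ 0) :
    ∃ k ≤ f.natDegree, ∃ u : Bˣ, Polynomial.aeval x f = x ^ k * u := by
  obtain ⟨g, hg, hdvd⟩ := f.exists_eq_pow_rootMultiplicity_mul_and_not_dvd hf 0
  rw [map_zero, sub_zero] at hg hdvd
  have hg0 : g.coeff 0 ≠ 0 := fun h => hdvd (Polynomial.X_dvd_iff.mpr h)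
  have hunit : IsUnit (Polynomial.aeval x g) := by
    rw [← g.divX_mul_X_add, map_add, map_mul, Polynomial.aeval_X, Polynomial.aeval_C]
    have hc : IsUnit (algebraMap F B (g.coeff 0)) := hg0.isUnit.map _
    exact ((Commute.all _ _).isNilpotent_mul_left hx).isUnit_add_right_of_commute hc
      (Commute.all _ _)
  refine ⟨f.rootMultiplicity 0, ?_, hunit.unit, ?_⟩
  · calc f.rootMultiplicity 0 ≤ f.roots.card := by
          classical rw [← Polynomial.count_roots]; exact Multiset.count_le_card _ _
      _ ≤ f.natDegree := f.card_roots'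
  · conv_lhs => rw [hg]
    simp

theorem le_finrank_range_aeval {F B : Type*} [Field F] [CommRing B] [Algebra F B]
    [FiniteDimensional F B] {x : B} {m : ℕ} (hx : x ^ m = 0) (hx' : x ^ (m - 1) ≠ 0) :
    m ≤ Module.finrank F (LinearMap.range (Polynomial.aeval (R := F) x).toLinearMap) := by
  rw [← Module.finrank_fin_fun F (n := m), ← (Polynomial.degreeLTEquiv F m).finrank_eq]
  let T := ((Polynomial.aeval (R := F) x).toLinearMap.rangeRestrict).comp
    (Polynomial.degreeLT F m).subtype
  refine LinearMap.finrank_le_finrank_of_injective (f := T) ?_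
  rw [← LinearMap.ker_eq_bot, LinearMap.ker_eq_bot']
  rintro ⟨f, hf⟩ h
  have h0 : Polynomial.aeval x f = 0 := congrArg Subtype.val h
  by_contra hne
  have hf0 : f ≠ 0 := fun h => hne (Subtype.ext h)
  obtain ⟨k, hk, u, hu⟩ := Polynomial.aeval_eq_pow_mul_unit_of_isNilpotent ⟨m, hx⟩ hf0
  rw [Polynomial.mem_degreeLT, Polynomial.degree_eq_natDegree hf0, Nat.cast_lt] at hf
  rw [hu, Units.mul_left_eq_zero] at h0
  exact hx' (pow_eq_zero_of_le (by omega) h0)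

/-- If `B` is local with maximal ideal `(x, y)` and has dimension `m + r ≤ 2m - 2`, where `m` is the
nilpotency index of `x`, then `(x, y) ^ (r + 1)` consists of polynomials in `x`. -/
theorem Ideal.span_pair_pow_le_range_aeval {F B : Type*} [Field F] [CommRing B] [Algebra F B]
    [FiniteDimensional F B] {x y : B} {m : ℕ} (hx : x ^ m = 0) (hx' : x ^ (m - 1) ≠ 0)
    (hy : IsNilpotent y) (hd : Module.finrank F B + 2 ≤ 2 * m)
    (hB : ∀ b : B, ∃ c : F, b - algebraMap F B c ∈ Ideal.span {x, y}) :
    ((Ideal.span {x, y}) ^ (Module.finrank F B - m + 1)).restrictScalars F ≤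
      LinearMap.range (Polynomial.aeval (R := F) x).toLinearMap := by
  have hbot := Ideal.span_pair_pow_eq_bot hx hx' hy hd
  have hm := le_finrank_range_aeval (F := F) hx hx'
  have hmB := hm.trans (Submodule.finrank_le _)
  set M : Ideal B := Ideal.span {x, y}
  set A := LinearMap.range (Polynomial.aeval (R := F) x).toLinearMap
  have hmem : x ∈ M := Ideal.subset_span (by simp)
  have hpow : ∀ i, x ^ i ∈ A := fun i => ⟨Polynomial.X ^ i, by simp⟩
  have hstep : ∀ j, 1 ≤ j → (M ^ j).restrictScalars F ≤ A ⊔ (M ^ (j + 1)).restrictScalars F →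
      (M ^ j).restrictScalars F ≤ A := by
    intro j hj h
    have hspan : M ^ j = Ideal.span {x ^ j} := by
      refine le_antisymm (Submodule.le_of_le_sup_smul_of_pow_eq_bot hbot ?_) ?_
      · intro p hp
        rw [smul_eq_mul, ← pow_succ']
        obtain ⟨a, ⟨g, hg⟩, q, hq, rfl⟩ := Submodule.mem_sup.mp (h hp)
        refine Submodule.add_mem_sup ?_ hq
        have haM : a ∈ M ^ j := by
          have := Ideal.sub_mem _ hp (Ideal.pow_le_pow_right (Nat.le_succ j) hq)
          rwa [add_sub_cancel_right] at this
        have hg : Polynomial.aeval x g = a := hg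
        rcases eq_or_ne g 0 with rfl | hg0
        · rw [← hg, map_zero]; exact Ideal.zero_mem _
        obtain ⟨c, -, u, hu⟩ := Polynomial.aeval_eq_pow_mul_unit_of_isNilpotent ⟨m, hx⟩ hg0
        rw [← hg, hu] at haM ⊢
        rw [Ideal.mul_unit_mem_iff_mem _ u.isUnit] at haM ⊢
        rw [Ideal.mem_span_singleton]
        rcases le_or_gt j c with hjc | hjc
        · exact pow_dvd_pow x hjc
        rcases le_or_gt m c with hmc | hmc
        · rw [pow_eq_zero_of_le hmc hx]; exact dvd_zero _
        refine absurd ?_ hx'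
        have h1 : x ^ c * x ^ (m - 1 - c) ∈ M ^ (c + 1) * M ^ (m - 1 - c) :=
          Ideal.mul_mem_mul (Ideal.pow_le_pow_right hjc haM) (Ideal.pow_mem_pow hmem _)
        rw [← pow_add, ← pow_add, show c + 1 + (m - 1 - c) = m by omega, hbot,
          Submodule.mem_bot] at h1
        rwa [show c + (m - 1 - c) = m - 1 by omega] at h1
      · rw [Ideal.span_singleton_le_iff_mem]
        exact Ideal.pow_mem_pow hmem j
    have hdown : ∀ s i, m ≤ i + s → (M ^ (j + i)).restrictScalars F ≤ A := by
      intro s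
      induction s with
      | zero =>
        intro i hi p hp
        have hp : p ∈ M ^ (j + i) := hp
        have := Ideal.pow_le_pow_right (show m ≤ j + i by omega) hp
        rw [hbot, Submodule.mem_bot] at this
        rw [this]
        exact A.zero_mem
      | succ s ih =>
        intro i hi p hp
        have hp : p ∈ M ^ (j + i) := hp
        rw [Ideal.pow_add_eq_span_singleton_pow hmem hj hspan,
          Ideal.mem_span_singleton'] at hp
        obtain ⟨b, rfl⟩ := hp
        obtain ⟨c, hc⟩ := hB b
        have hsplit : b * x ^ (j + i) = c • x ^ (j + i) +
            (b - algebraMap F B c) * x ^ (j + i) := by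
          rw [Algebra.smul_def]; ring
        rw [hsplit]
        refine A.add_mem (A.smul_mem _ (hpow _)) (ih (i + 1) (by omega) ?_)
        show _ ∈ M ^ (j + (i + 1))
        rw [← add_assoc, pow_succ']
        exact Ideal.mul_mem_mul hc (Ideal.pow_mem_pow hmem _)
    exact hdown m 0 (by omega)
  by_contra hcon
  have hchain : ∀ i ≤ Module.finrank F B - m + 1,
      Module.finrank F ↥(A ⊔ (M ^ (i + 1)).restrictScalars F) + i ≤ Module.finrank F B := by
    intro i
    induction i with
    | zero => exact fun _ => Submodule.finrank_le _
    | succ i ih =>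
      intro hi
      have h1 := ih (by omega)
      have hanti : (M ^ (i + 1 + 1)).restrictScalars F ≤ (M ^ (i + 1)).restrictScalars F :=
        Ideal.pow_le_pow_right (Nat.le_succ _)
      have hlt : A ⊔ (M ^ (i + 1 + 1)).restrictScalars F <
          A ⊔ (M ^ (i + 1)).restrictScalars F := by
        refine lt_of_le_of_ne (sup_le_sup_left hanti _) fun h => hcon ?_
        have hle : (M ^ (Module.finrank F B - m + 1)).restrictScalars F ≤
          (M ^ (i + 1)).restrictScalars F := Ideal.pow_le_pow_right hi
        exact hle.trans (hstep (i + 1) (by omega) (le_sup_right.trans h.ge))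
      have := Submodule.finrank_lt_finrank_of_lt hlt
      omega
  have h1 := hchain _ le_rfl
  have h2 := Submodule.finrank_mono
    (le_sup_left : A ≤ A ⊔ (M ^ (Module.finrank F B - m + 1 + 1)).restrictScalars F)
  omega

theorem exists_polynomial_forall_apply_pow_mul_sub_eq_zero {F R : Type*} [Field F] [CommRing R]
    [Algebra F R] (ψ : R →ₗ[F] F) {x : R} {m : ℕ} (hx : x ^ m = 0) (hψ : ψ (x ^ (m - 1)) ≠ 0)
    (y : R) : ∃ f : Polynomial F, ∀ j, ψ (x ^ j * (y - Polynomial.aeval x f)) = 0 := by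
  have key : ∀ i ≤ m, ∃ f : Polynomial F, ∀ j, m ≤ j + i →
      ψ (x ^ j * (y - Polynomial.aeval x f)) = 0 := by
    intro i
    induction i with
    | zero =>
      intro _
      refine ⟨0, fun j hj => ?_⟩
      rw [pow_eq_zero_of_le (by omega) hx, zero_mul, map_zero]
    | succ i ih =>
      intro hi
      obtain ⟨f, hf⟩ := ih (by omega)
      refine ⟨f + Polynomial.C (ψ (x ^ (m - 1 - i) * (y - Polynomial.aeval x f)) /
        ψ (x ^ (m - 1))) * Polynomial.X ^ i, fun j hj => ?_⟩
      have hsplit : ∀ c : F, x ^ j * (y - Polynomial.aeval x (f + Polynomial.C c *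
          Polynomial.X ^ i)) = x ^ j * (y - Polynomial.aeval x f) - c • x ^ (j + i) := by
        intro c
        simp only [map_add, map_mul, map_pow, Polynomial.aeval_C, Polynomial.aeval_X,
          Algebra.smul_def]
        ring
      rw [hsplit, map_sub, map_smul, smul_eq_mul]
      rcases Nat.lt_or_ge (j + i) m with h | h
      · obtain rfl : j = m - 1 - i := by omega
        rw [show m - 1 - i + i = m - 1 by omega, div_mul_cancel₀ _ hψ, sub_self]
      · rw [hf j h, pow_eq_zero_of_le h hx, map_zero, mul_zero, sub_zero]
  obtain ⟨f, hf⟩ := key m le_rfl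
  exact ⟨f, fun j => hf j (by omega)⟩

/-- On a module of dimension `m + r ≤ 2m - 2`, some difference `y - f(x)` is annihilated by
`(x, y) ^ (r + 1)`. -/
theorem exists_polynomial_pow_mul_sub_smul_eq_zero {F R V : Type*} [Field F] [CommRing R]
    [Algebra F R] [AddCommGroup V] [Module F V] [Module R V] [IsScalarTower F R V]
    [FiniteDimensional F V] {x y : R} {m : ℕ} (hx : x ^ m = 0) (hy : IsNilpotent y)
    (hR : ∀ b : R, ∃ c : F, b - algebraMap F R c ∈ Ideal.span {x, y})
    {v : V} (hv : x ^ (m - 1) • v ≠ 0) (hd : Module.finrank F V + 2 ≤ 2 * m) :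
    m ≤ Module.finrank F V ∧ ∃ f : Polynomial F,
      ∀ p ∈ (Ideal.span {x, y}) ^ (Module.finrank F V - m + 1), ∀ u : V,
      (p * (y - Polynomial.aeval x f)) • u = 0 := by
  obtain ⟨φ, hφ⟩ : ∃ φ : Module.Dual F V, φ (x ^ (m - 1) • v) ≠ 0 := by
    by_contra! h
    exact hv ((Module.forall_dual_apply_eq_zero_iff F _).mp h)
  let T : R →ₗ[R] V := LinearMap.toSpanSingleton R V v
  let I : Ideal R :=
    { carrier := {p | ∀ q, φ ((q * p) • v) = 0}
      zero_mem' := fun q => by simp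
      add_mem' := fun {a b} ha hb q => by rw [mul_add, add_smul, map_add, ha, hb, add_zero]
      smul_mem' := fun c a ha q => by rw [smul_eq_mul, ← mul_assoc]; exact ha _ }
  have hI0 : ∀ p ∈ I, φ (p • v) = 0 := fun p hp => by simpa using hp 1
  obtain ⟨f, hf⟩ := exists_polynomial_forall_apply_pow_mul_sub_eq_zero
    (φ ∘ₗ T.restrictScalars F) hx hφ y
  let N : Submodule R V := Submodule.map T I
  have hker : LinearMap.ker (N.mkQ ∘ₗ T) = I := by
    ext p
    rw [LinearMap.mem_ker, LinearMap.comp_apply, Submodule.mkQ_apply, Submodule.Quotient.mk_eq_zero]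
    refine ⟨?_, fun hp => ⟨p, hp, rfl⟩⟩
    rintro ⟨i, hi, hip⟩ q
    have hip : i • v = p • v := hip
    rw [mul_smul, ← hip, ← mul_smul]
    exact hi q
  let e : (R ⧸ I) ≃ₗ[R] LinearMap.range (N.mkQ ∘ₗ T) :=
    (Submodule.quotEquivOfEq _ _ hker.symm).trans (N.mkQ ∘ₗ T).quotKerEquivRange
  let eF : (R ⧸ I) ≃ₗ[F] (LinearMap.range (N.mkQ ∘ₗ T)).restrictScalars F := e.restrictScalars F
  have hfinV : FiniteDimensional F (V ⧸ N) :=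
    Module.Finite.of_surjective (N.mkQ.restrictScalars F) N.mkQ_surjective
  have hfin : FiniteDimensional F (R ⧸ I) := Module.Finite.equiv eF.symm
  have hrank := eF.finrank_eq
  have hquot : Module.finrank F (V ⧸ N) + Module.finrank F (N.restrictScalars F) =
      Module.finrank F V := (N.restrictScalars F).finrank_quotient_add_finrank
  have hrange : Module.finrank F (R ⧸ I) ≤ Module.finrank F (V ⧸ N) := by
    rw [hrank]; exact Submodule.finrank_le _
  let π : R →+* R ⧸ I := Ideal.Quotient.mk I
  have hπ : ∀ c : F, π (algebraMap F R c) = algebraMap F (R ⧸ I) c := fun _ => rfl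
  have hmap : (Ideal.span {x, y}).map π = Ideal.span {π x, π y} := by
    rw [Ideal.map_span, Set.image_pair]
  have hπx : π x ^ m = 0 := by rw [← map_pow, hx, map_zero]
  have hπx' : π x ^ (m - 1) ≠ 0 := by
    rw [← map_pow]
    exact fun h => hφ (hI0 _ (Ideal.Quotient.eq_zero_iff_mem.mp h))
  have hmB : m ≤ Module.finrank F (R ⧸ I) :=
    (le_finrank_range_aeval (F := F) hπx hπx').trans (Submodule.finrank_le _)
  have hcore := Ideal.span_pair_pow_le_range_aeval (F := F) hπx hπx' (hy.map π) (by omega)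
    (by
      intro b
      obtain ⟨b, rfl⟩ := Ideal.Quotient.mk_surjective b
      obtain ⟨c, hc⟩ := hR b
      refine ⟨c, ?_⟩
      rw [← hmap, ← hπ, ← map_sub]
      exact Ideal.mem_map_of_mem π hc)
  obtain ⟨k, hk⟩ := Ideal.exists_span_pair_pow_eq_bot ⟨m, hx⟩ hy
  set M : Ideal R := Ideal.span {x, y}
  set z := y - Polynomial.aeval x f
  have hmid : ∀ p ∈ M ^ (Module.finrank F (R ⧸ I) - m + 1), p * z ∈ I := by
    intro p hp q
    have hqp : π (q * p) ∈ (Ideal.span {π x, π y}) ^ (Module.finrank F (R ⧸ I) - m + 1) := by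
      rw [← hmap, ← Ideal.map_pow]
      exact Ideal.mem_map_of_mem π (Ideal.mul_mem_left _ _ hp)
    obtain ⟨g, hg⟩ := hcore hqp
    have hg : Polynomial.aeval (π x) g = π (q * p) := hg
    have hg' : Polynomial.aeval (π x) g = π (Polynomial.aeval x g) :=
      Polynomial.aeval_algHom_apply (Ideal.Quotient.mkₐ F I) x g
    have hdiff : q * p - Polynomial.aeval x g ∈ I :=
      (Ideal.Quotient.mk_eq_mk_iff_sub_mem _ _).mp (hg.symm.trans hg')
    have hpoly : φ ((Polynomial.aeval x g * z) • v) = 0 := by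
      rw [Polynomial.aeval_eq_sum_range, Finset.sum_mul, Finset.sum_smul, map_sum]
      refine Finset.sum_eq_zero fun i _ => ?_
      rw [smul_mul_assoc, smul_assoc, map_smul]
      have : φ ((x ^ i * z) • v) = 0 := hf i
      rw [this, smul_zero]
    have hsplit : q * (p * z) = z * (q * p - Polynomial.aeval x g) + Polynomial.aeval x g * z := by
      ring
    rw [hsplit, add_smul, map_add, hdiff z, hpoly, add_zero]
  have htop : ∀ p ∈ M ^ (Module.finrank F (V ⧸ N) - Module.finrank F (R ⧸ I)), ∀ u : V,
      ∃ q : R, p • u = q • v := by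
    intro p hp u
    have h := Submodule.pow_smul_le_of_finrank_le (F := F) hk
      (Module.finrank F (V ⧸ N) - Module.finrank F (R ⧸ I))
      (le_top : LinearMap.range (N.mkQ ∘ₗ T) ≤ ⊤)
      ((Submodule.finrank_le _).trans (by omega))
    obtain ⟨q, hq⟩ := h (Submodule.smul_mem_smul hp (Submodule.mem_top (x := N.mkQ u)))
    rw [← map_smul, LinearMap.comp_apply, ← sub_eq_zero, ← map_sub, Submodule.mkQ_apply,
      Submodule.Quotient.mk_eq_zero] at hq
    obtain ⟨i, -, hi⟩ := hq
    refine ⟨q - i, ?_⟩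
    have hi : i • v = q • v - p • u := hi
    rw [sub_smul, hi, sub_sub_cancel]
  have hbotN : ∀ p ∈ M ^ Module.finrank F (N.restrictScalars F), ∀ u ∈ N, p • u = 0 := by
    intro p hp u hu
    have h := Submodule.pow_smul_le_of_finrank_le (F := F) hk
      (Module.finrank F (N.restrictScalars F)) (bot_le : ⊥ ≤ N) (by omega)
    exact (Submodule.mem_bot R).mp (h (Submodule.smul_mem_smul hp hu))
  have hupper : ∀ p ∈ M ^ (Module.finrank F (R ⧸ I) - m + 1) *
      M ^ (Module.finrank F (V ⧸ N) - Module.finrank F (R ⧸ I)), ∀ u : V, (p * z) • u ∈ N := by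
    intro p hp
    refine Submodule.mul_induction_on hp (fun a ha b hb u => ?_) fun a b ha hb u => ?_
    · obtain ⟨q, hq⟩ := htop b hb u
      rw [show a * b * z = a * z * b by ring, mul_smul, hq, ← mul_smul, mul_comm]
      exact ⟨q * (a * z), I.mul_mem_left q (hmid a ha), rfl⟩
    · rw [add_mul, add_smul]
      exact N.add_mem (ha u) (hb u)
  refine ⟨by omega, f, fun p hp => ?_⟩
  rw [show Module.finrank F V - m + 1 = Module.finrank F (N.restrictScalars F) +
    (Module.finrank F (R ⧸ I) - m + 1 + (Module.finrank F (V ⧸ N) - Module.finrank F (R ⧸ I)))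
    by omega, pow_add, pow_add M (_ + 1)] at hp
  refine Submodule.mul_induction_on hp (fun a ha b hb u => ?_) fun a b ha hb u => ?_
  · rw [mul_assoc, mul_smul]
    exact hbotN a ha _ (hupper b hb u)
  · rw [add_mul, add_smul, ha u, hb u, add_zero]

theorem exists_eq_ceil_div_of_finrank {F R V : Type*} [Field F] [CommRing R]
    [Algebra F R] [AddCommGroup V] [Module F V] [Module R V] [IsScalarTower F R V]
    [FaithfulSMul R V] [FiniteDimensional F V] {x y : R} {m l : ℕ}
    (hx : x ^ m = 0) (hx' : x ^ (m - 1) ≠ 0) (hy : y ^ l = 0) (hy' : y ^ (l - 1) ≠ 0)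
    (hR : ∀ b : R, ∃ c : F, b - algebraMap F R c ∈ Ideal.span {x, y})
    (hd : Module.finrank F V + 2 ≤ 2 * m) (hl : Module.finrank F V + 2 < l + m) :
    ∃ p : ℕ, 1 ≤ p ∧ l = (m + p - 1) / p := by
  have hsmul : ∀ p : R, (∀ u : V, p • u = 0) → p = 0 := fun p h =>
    FaithfulSMul.eq_of_smul_eq_smul (α := V) fun u => by rw [h u, zero_smul]
  obtain ⟨v, hv⟩ : ∃ v : V, x ^ (m - 1) • v ≠ 0 := by
    by_contra! h
    exact hx' (hsmul _ h)
  obtain ⟨hmV, f, hf⟩ := exists_polynomial_pow_mul_sub_smul_eq_zero (F := F) hx ⟨l, hy⟩ hR hv hd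
  have hm : 1 ≤ m := by omega
  have hf := fun p hp => hsmul _ (hf p hp)
  set M : Ideal R := Ideal.span {x, y}
  have hxM : x ∈ M := Ideal.subset_span (by simp)
  have hyM : y ∈ M := Ideal.subset_span (by simp)
  have hxr : x ^ (Module.finrank F V - m + 1) ≠ 0 := fun h =>
    hx' (pow_eq_zero_of_le (by omega) h)
  have hnotunit : ∀ u : Rˣ, Polynomial.aeval x f ≠ u := by
    intro u hu
    have h := hf _ (Ideal.pow_mem_pow hxM _)
    rw [hu] at h
    have hunit : IsUnit (y - u) := by
      rw [sub_eq_add_neg]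
      exact IsNilpotent.isUnit_add_right_of_commute ⟨l, hy⟩ u.isUnit.neg (Commute.all _ _)
    exact hxr (hunit.mul_left_eq_zero.mp h)
  have hpow : ∀ j, Module.finrank F V - m + 2 ≤ j → Polynomial.aeval x f ∈ M →
      y ^ j = (Polynomial.aeval x f) ^ j := by
    intro j hj hfM
    rw [← sub_eq_zero, ← (Commute.all _ _).geom_sum₂_mul]
    refine hf _ (Ideal.sum_mem _ fun i hi => ?_)
    have hi := Finset.mem_range.mp hi
    refine Ideal.pow_le_pow_right
      (show Module.finrank F V - m + 1 ≤ i + (j - 1 - i) by omega) ?_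
    rw [pow_add]
    exact Ideal.mul_mem_mul (Ideal.pow_mem_pow hyM _) (Ideal.pow_mem_pow hfM _)
  rcases eq_or_ne f 0 with rfl | hf0
  · have h := hpow (l - 1) (by omega) (by simp)
    rw [map_zero, zero_pow (by omega)] at h
    exact absurd h hy'
  obtain ⟨k, -, u, hu⟩ := Polynomial.aeval_eq_pow_mul_unit_of_isNilpotent ⟨m, hx⟩ hf0
  have hk : 1 ≤ k := by
    rw [Nat.one_le_iff_ne_zero]
    rintro rfl
    exact hnotunit u (by simpa using hu)
  have hfM : Polynomial.aeval x f ∈ M := by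
    rw [hu]
    exact Ideal.mul_mem_right _ _ (Ideal.pow_mem_of_mem M hxM k hk)
  have h1 := hpow l (by omega) hfM
  have h2 := hpow (l - 1) (by omega) hfM
  rw [hy, hu, mul_pow, ← pow_mul, ← Units.val_pow_eq_pow_val, eq_comm,
    Units.mul_left_eq_zero] at h1
  rw [h2, hu, mul_pow, ← pow_mul, ← Units.val_pow_eq_pow_val, ne_eq,
    Units.mul_left_eq_zero] at hy'
  have h3 : m ≤ k * l := by
    by_contra! h
    exact hx' (pow_eq_zero_of_le (by omega) h1)
  have h4 : k * (l - 1) < m := by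
    by_contra! h
    exact hy' (pow_eq_zero_of_le h hx)
  refine ⟨k, hk, ?_⟩
  obtain ⟨t, rfl⟩ : ∃ t, l = t + 1 := ⟨l - 1, by omega⟩
  rw [Nat.add_sub_cancel] at h4
  symm
  rw [Nat.div_eq_iff (by omega)]
  have h5 : (t + 1) * k = k * t + k := by ring
  rw [mul_comm] at h3
  omega

theorem exists_sub_algebraMap_mem_span_pair {F A : Type*} [Field F] [CommRing A] [Algebra F A]
    {x y : A} (h : Algebra.adjoin F {x, y} = ⊤) (b : A) :
    ∃ c : F, b - algebraMap F A c ∈ Ideal.span {x, y} := by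
  have hb : b ∈ Algebra.adjoin F {x, y} := h ▸ Algebra.mem_top
  induction hb using Algebra.adjoin_induction with
  | mem z hz => exact ⟨0, by simpa using Ideal.subset_span hz⟩
  | algebraMap r => exact ⟨r, by simp⟩
  | add a b _ _ ha hb =>
    obtain ⟨c, hc⟩ := ha
    obtain ⟨d, hd⟩ := hb
    refine ⟨c + d, ?_⟩
    rw [map_add, add_sub_add_comm]
    exact Ideal.add_mem _ hc hd
  | mul a b _ _ ha hb =>
    obtain ⟨c, hc⟩ := ha
    obtain ⟨d, hd⟩ := hb
    refine ⟨c * d, ?_⟩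
    rw [map_mul, show a * b - algebraMap F A c * algebraMap F A d =
      b * (a - algebraMap F A c) + algebraMap F A c * (b - algebraMap F A d) by ring]
    exact Ideal.add_mem _ (Ideal.mul_mem_left _ _ hc) (Ideal.mul_mem_left _ _ hd)


/-- Theorem 2.1: if `X`, `Y` are commuting nilpotent endomorphisms of an
`n`-dimensional space over an algebraically closed field, `m = h(X)` satisfies
`m ≥ n/2 + 1` (i.e. `2m ≥ n + 2`) and `l = h(Y)` satisfies `l > n - m + 2`
(i.e. `l + m > n + 2`), then `l = ⌈m/p⌉` for some positive integer `p`. -/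
theorem stmt8 (F : Type*) [Field F] [IsAlgClosed F]
    (V : Type*) [AddCommGroup V] [Module F V] [FiniteDimensional F V]
    (n : ℕ) (hn : n = Module.finrank F V)
    (X Y : V →ₗ[F] V) (hc : Commute X Y)
    (m l : ℕ) (hm1 : 1 ≤ m) (hmX : X ^ m = 0) (hmX' : m = 1 ∨ X ^ (m - 1) ≠ 0)
    (hl1 : 1 ≤ l) (hlY : Y ^ l = 0) (hlY' : l = 1 ∨ Y ^ (l - 1) ≠ 0)
    (hm : 2 * m ≥ n + 2) (hl : l + m > n + 2) :
    ∃ p : ℕ, 1 ≤ p ∧ l = (m + p - 1) / p := by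
  subst hn
  have hcomm : ∀ a ∈ ({X, Y} : Set (Module.End F V)), ∀ b ∈ ({X, Y} : Set (Module.End F V)),
      a * b = b * a := by
    rintro a (rfl | rfl) b (rfl | rfl)
    exacts [rfl, hc.eq, hc.symm.eq, rfl]
  have hX' : X ^ (m - 1) ≠ 0 := by
    rcases hmX' with rfl | h
    · have : Subsingleton V := Module.finrank_zero_iff.mp (by omega : Module.finrank F V = 0)
      rcases hlY' with rfl | h
      · omega
      · exact absurd (Subsingleton.elim _ _) h
    · exact h
  rcases hlY' with rfl | hY'
  · exact ⟨m, hm1, by rw [Nat.div_eq_of_lt_le] <;> omega⟩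
  let _ : CommRing (Algebra.adjoin F ({X, Y} : Set (Module.End F V))) :=
    { (inferInstance : Ring (Algebra.adjoin F ({X, Y} : Set (Module.End F V)))) with
      mul_comm := (Algebra.isMulCommutative_adjoin F hcomm).is_comm.comm }
  have hxmem : X ∈ Algebra.adjoin F ({X, Y} : Set (Module.End F V)) :=
    Algebra.subset_adjoin (by simp)
  have hymem : Y ∈ Algebra.adjoin F ({X, Y} : Set (Module.End F V)) :=
    Algebra.subset_adjoin (by simp)
  let x : Algebra.adjoin F ({X, Y} : Set (Module.End F V)) := ⟨X, hxmem⟩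
  let y : Algebra.adjoin F ({X, Y} : Set (Module.End F V)) := ⟨Y, hymem⟩
  have hgen : Algebra.adjoin F {x, y} = ⊤ := by
    have h := Algebra.adjoin_adjoin_coe_preimage (R := F) (s := ({X, Y} : Set (Module.End F V)))
    convert h using 2
    ext z
    simp [x, y, Subtype.ext_iff]
  refine exists_eq_ceil_div_of_finrank (F := F) (V := V) (x := x) (y := y)
    (Subtype.ext hmX) (fun h => hX' (congrArg Subtype.val h))
    (Subtype.ext hlY) (fun h => hY' (congrArg Subtype.val h))
    (exists_sub_algebraMap_mem_span_pair hgen) hm hl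
end

section
/- Let X, Y be commuting nilpotent endomorphisms of an n-dimensional vector space over an algebraically closed field with m := h(X) ≥ n/2 + 1. Then every Jordan block size l of Y satisfying l > n − m + 2 and l > ⌈m/2⌉ must equal m. -/
open Polynomial

section
variable {F V : Type*} [Field F] [AddCommGroup V] [Module F V]

theorem pow_apply_aeval_of_coeff_eq_zero {X : Module.End F V} {m : ℕ} (hX : X ^ m = 0)
    {p : F[X]} {a : ℕ} (ha : a < m) (hp : ∀ i < a, p.coeff i = 0) (e : V) :
    (X ^ (m - 1 - a)) (aeval X p e) = p.coeff a • (X ^ (m - 1)) e := by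
  obtain ⟨q, rfl⟩ := X_pow_dvd_iff.2 hp
  have hq : q = C (q.coeff 0) + Polynomial.X * q.divX := by
    rw [add_comm, X_mul_divX_add]
  have hcoeff : (Polynomial.X ^ a * q).coeff a = q.coeff 0 := by
    simpa using coeff_X_pow_mul q a 0
  rw [hcoeff]
  have key : X ^ (m - 1 - a) * aeval X (Polynomial.X ^ a * q) = q.coeff 0 • X ^ (m - 1) := by
    have h1 : X ^ (m - 1 - a) * X ^ a = X ^ (m - 1) := by
      rw [← pow_add]; congr 1; omega
    have h2 : X ^ (m - 1) * X = 0 := by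
      rw [← pow_succ, ← hX]; congr 1; omega
    conv_lhs => rw [hq]
    simp only [map_mul, map_add, map_pow, aeval_X, aeval_C, mul_add]
    rw [← mul_assoc, ← mul_assoc (X ^ (m - 1 - a)), h1, ← mul_assoc, h2, zero_mul, add_zero,
      ← Algebra.commutes, Algebra.smul_def]
  exact LinearMap.congr_fun key e

theorem X_pow_dvd_of_forall_apply_eq_zero {X : Module.End F V} {m : ℕ} (hX : X ^ m = 0)
    {e : V} (φ : Module.Dual F V) (hφ : φ ((X ^ (m - 1)) e) ≠ 0) {p : F[X]}
    (hp : ∀ i < m, φ ((X ^ i) (aeval X p e)) = 0) : Polynomial.X ^ m ∣ p := by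
  rw [X_pow_dvd_iff]
  intro a
  induction a using Nat.strong_induction_on with
  | _ a ih =>
    intro ha
    have h := hp (m - 1 - a) (by omega)
    rw [pow_apply_aeval_of_coeff_eq_zero hX ha (fun i hi => ih i hi (hi.trans ha)), map_smul,
      smul_eq_mul] at h
    exact (mul_eq_zero.1 h).resolve_right hφ

theorem eq_bot_of_le_map_sup_map {A B : Module.End F V} (hAB : Commute A B)
    (hA : IsNilpotent A) (hB : IsNilpotent B) {S : Submodule F V}
    (hBS : S.map B ≤ S) (hS : S ≤ S.map A ⊔ S.map B) : S = ⊥ := by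
  obtain ⟨a, ha⟩ := hA
  obtain ⟨b, hb⟩ := hB
  have hmap (C D : Module.End F V) : (S.map D).map C = S.map (C * D) :=
    (Submodule.map_comp _ _ _).symm
  have h1 : ∀ k : ℕ, S ≤ S.map A ⊔ S.map (B ^ k) := by
    intro k
    induction k with
    | zero => simp [Module.End.one_eq_id]
    | succ k ih =>
      refine hS.trans (sup_le le_sup_left ((Submodule.map_mono ih).trans ?_))
      rw [Submodule.map_sup, hmap, hmap, ← pow_succ', ← hAB.eq, ← hmap]
      exact sup_le_sup_right (Submodule.map_mono hBS) _
  have h2 : S ≤ S.map A := by simpa [hb] using h1 b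
  have h3 : ∀ k : ℕ, S ≤ S.map (A ^ k) := by
    intro k
    induction k with
    | zero => simp [Module.End.one_eq_id]
    | succ k ih =>
      refine h2.trans ((Submodule.map_mono ih).trans ?_)
      rw [hmap, ← pow_succ']
  simpa [ha] using h3 a

/-- The submodules `(A, B)ᵏ S` spanned by the images of `S` under words of length `k`. -/
def wordFiltration (A B : Module.End F V) (S : Submodule F V) : ℕ → Submodule F V
  | 0 => S
  | k + 1 => (wordFiltration A B S k).map A ⊔ (wordFiltration A B S k).map B

section wordFiltration

variable {A B : Module.End F V} {S : Submodule F V}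

theorem apply_left_mem_wordFiltration {k : ℕ} {v : V} (hv : v ∈ wordFiltration A B S k) :
    A v ∈ wordFiltration A B S (k + 1) :=
  Submodule.mem_sup_left (Submodule.mem_map_of_mem hv)

theorem apply_right_mem_wordFiltration {k : ℕ} {v : V} (hv : v ∈ wordFiltration A B S k) :
    B v ∈ wordFiltration A B S (k + 1) :=
  Submodule.mem_sup_right (Submodule.mem_map_of_mem hv)

theorem pow_apply_mem_wordFiltration {k : ℕ} {v : V} (hv : v ∈ wordFiltration A B S k) (j : ℕ) :
    (A ^ j) v ∈ wordFiltration A B S (k + j) := by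
  induction j with
  | zero => simpa
  | succ j ih =>
    rw [pow_succ']
    exact apply_left_mem_wordFiltration ih

theorem wordFiltration_succ_le (hA : S.map A ≤ S) (hB : S.map B ≤ S) (k : ℕ) :
    wordFiltration A B S (k + 1) ≤ wordFiltration A B S k := by
  induction k with
  | zero => exact sup_le hA hB
  | succ k ih => exact sup_le_sup (Submodule.map_mono ih) (Submodule.map_mono ih)

theorem wordFiltration_le (hA : S.map A ≤ S) (hB : S.map B ≤ S) (k : ℕ) :
    wordFiltration A B S k ≤ S :=
  antitone_nat_of_succ_le (wordFiltration_succ_le hA hB) (Nat.zero_le k)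

theorem finrank_wordFiltration_le [FiniteDimensional F V] (hAB : Commute A B)
    (hAn : IsNilpotent A) (hBn : IsNilpotent B) (hA : S.map A ≤ S) (hB : S.map B ≤ S) (k : ℕ) :
    Module.finrank F (wordFiltration A B S k) ≤ Module.finrank F S - k := by
  induction k with
  | zero => exact le_rfl
  | succ k ih =>
    have hle := wordFiltration_succ_le hA hB k
    rcases hle.lt_or_eq with h | h
    · have := Submodule.finrank_lt_finrank_of_lt h
      omega
    · have : wordFiltration A B S k = ⊥ :=
        eq_bot_of_le_map_sup_map hAB hAn hBn (le_sup_right.trans hle) h.ge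
      rw [h, this]
      simp

theorem wordFiltration_eq_bot [FiniteDimensional F V] (hAB : Commute A B)
    (hAn : IsNilpotent A) (hBn : IsNilpotent B) (hA : S.map A ≤ S) (hB : S.map B ≤ S)
    {k : ℕ} (hk : Module.finrank F S ≤ k) : wordFiltration A B S k = ⊥ := by
  have := finrank_wordFiltration_le hAB hAn hBn hA hB k
  exact Submodule.finrank_eq_zero.1 (by omega)

end wordFiltration

section Complement

variable {X Z : Module.End F V} {U W : Submodule F V} {m r : ℕ}

theorem commute_projection (hWU : IsCompl W U) (hXU : U.map X ≤ U) (hXW : W.map X ≤ W) :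
    Commute X (W.projection U hWU) := by
  refine LinearMap.ext fun v => ?_
  obtain ⟨w, hw, u, hu, rfl⟩ := Submodule.mem_sup.1 (hWU.sup_eq_top ▸ Submodule.mem_top : v ∈ W ⊔ U)
  have hXw : X w ∈ W := hXW (Submodule.mem_map_of_mem hw)
  have hXu : X u ∈ U := hXU (Submodule.mem_map_of_mem hu)
  simp [Submodule.projection_apply_of_mem_left, Submodule.projection_apply_of_mem_right,
    hw, hu, hXw, hXu]

theorem sub_projection_mem (hWU : IsCompl W U) (v : V) : v - W.projection U hWU v ∈ U := by
  rw [← Submodule.projection_apply_eq_zero_iff hWU, map_sub,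
    Submodule.projection_apply_of_mem_left hWU (Submodule.projection_apply_mem hWU v), sub_self]

theorem pow_apply_eq_zero_of_finrank_le [FiniteDimensional F V] (hXn : IsNilpotent X)
    (hXW : W.map X ≤ W) (hr : Module.finrank F W ≤ r) {w : V} (hw : w ∈ W) : (X ^ r) w = 0 := by
  have h := pow_apply_mem_wordFiltration (A := X) (B := 0) (k := 0) hw r
  rw [zero_add, wordFiltration_eq_bot (Commute.zero_right X) hXn IsNilpotent.zero hXW
    (by simp) hr] at h
  simpa using h

/-- The compression of `Z` to a complement `W` of `U` is nilpotent, if the component of `Z w` in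
`U` lies in the range of `X` for every `w ∈ W`. -/
theorem isNilpotent_projection_mul (hXZ : Commute X Z) (hXn : IsNilpotent X)
    (hZn : IsNilpotent Z) (hWU : IsCompl W U) (hXU : U.map X ≤ U) (hXW : W.map X ≤ W)
    (hU : ∀ w ∈ W, Z w - W.projection U hWU (Z w) ∈ LinearMap.range X) :
    IsNilpotent (W.projection U hWU * Z) := by
  set π := W.projection U hWU with hπ
  have hXπ : Commute X π := commute_projection hWU hXU hXW
  set D := π * Z with hD
  have hXD : Commute X D := hXπ.mul_right hXZ
  have hDW : ∀ v, D v ∈ W := fun v => Submodule.projection_apply_mem hWU _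
  have hZR : ∀ v ∈ LinearMap.range X, Z v ∈ LinearMap.range X := by
    rintro _ ⟨v, rfl⟩
    exact ⟨Z v, LinearMap.congr_fun hXZ.eq v⟩
  obtain ⟨N, hN⟩ := hZn
  obtain ⟨M, hM⟩ := hXn
  have h1 : ∀ k : ℕ, ∀ w ∈ W, (D ^ k) w ∈ W ∧ (Z ^ k) w - (D ^ k) w ∈ LinearMap.range X := by
    intro k
    induction k with
    | zero => intro w hw; simpa using hw
    | succ k ih =>
      intro w hw
      obtain ⟨h1, h2⟩ := ih w hw
      rw [pow_succ', pow_succ', Module.End.mul_apply, Module.End.mul_apply]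
      refine ⟨hDW _, ?_⟩
      have := add_mem (hZR _ h2) (hU _ h1)
      rw [map_sub, sub_add_sub_cancel] at this
      exact this
  have h2 : ∀ v, (D ^ (N + 1)) v ∈ LinearMap.range X := by
    intro v
    rw [pow_succ, Module.End.mul_apply]
    have := (h1 N _ (hDW v)).2
    rwa [hN, LinearMap.zero_apply, zero_sub, neg_mem_iff] at this
  have h3 : ∀ k : ℕ, ∀ v, (D ^ ((N + 1) * k)) v ∈ LinearMap.range (X ^ k) := by
    intro k
    induction k with
    | zero => intro v; exact ⟨v, by simp⟩
    | succ k ih =>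
      intro v
      obtain ⟨v', hv'⟩ := ih v
      obtain ⟨v'', hv''⟩ := h2 v'
      refine ⟨v'', ?_⟩
      rw [mul_add, mul_one, add_comm _ (N + 1), pow_add D, Module.End.mul_apply, ← hv',
        ← Module.End.mul_apply (D ^ (N + 1)), ← (hXD.pow_pow k (N + 1)).eq, Module.End.mul_apply,
        ← hv'', pow_succ, Module.End.mul_apply]
  refine ⟨(N + 1) * M, LinearMap.ext fun v => ?_⟩
  simpa [hM, eq_comm] using h3 M v

theorem pow_mul_pow_eq_zero [FiniteDimensional F V] (hXZ : Commute X Z) (hXn : IsNilpotent X)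
    (hZn : IsNilpotent Z) (hWU : IsCompl W U) (hXU : U.map X ≤ U) (hXW : W.map X ≤ W)
    (hr : Module.finrank F W ≤ r) (hrm : r + 2 ≤ m)
    (hU : ∀ u ∈ U, ∀ j ≤ m, (X ^ j) u = 0 → ∃ u' ∈ U, u = (X ^ (m - j)) u')
    (hZU : ∀ u ∈ U, Z u ∈ W) {i j : ℕ} (hj : 1 ≤ j) (hij : r + 2 ≤ i + j) :
    X ^ i * Z ^ j = 0 := by
  have happ (A B : Module.End F V) (h : Commute A B) (v : V) : A (B v) = B (A v) :=
    LinearMap.congr_fun h.eq v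
  have hXU' (k : ℕ) {u : V} (hu : u ∈ U) : (X ^ k) u ∈ U := by
    induction k with
    | zero => simpa
    | succ k ih => rw [pow_succ']; exact hXU (Submodule.mem_map_of_mem ih)
  have hπ (v : V) := sub_projection_mem hWU v
  set π := W.projection U hWU with hπdef
  have hXπ : Commute X π := commute_projection hWU hXU hXW
  set D := π * Z with hD
  have hXD : Commute X D := hXπ.mul_right hXZ
  have hDv (v : V) : D v = π (Z v) := rfl
  have hDW : W.map D ≤ W := by
    rintro _ ⟨v, -, rfl⟩
    exact Submodule.projection_apply_mem hWU _
  have hXr {w : V} (hw : w ∈ W) : (X ^ r) w = 0 := pow_apply_eq_zero_of_finrank_le hXn hXW hr hw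
  have hlift {k : ℕ} (hk : k ≤ r) {w : V} (hw : (X ^ (r - k)) w = 0) :
      ∃ u ∈ U, Z w - D w = (X ^ (k + 2)) u := by
    obtain ⟨u, hu, h⟩ := hU _ (hπ (Z w)) (r - k) (by omega) (by
      rw [map_sub, happ _ _ (hXZ.pow_left _), happ _ _ (hXπ.pow_left _),
        happ _ _ (hXZ.pow_left _), hw]
      simp)
    refine ⟨(X ^ (m - (r - k) - (k + 2))) u, hXU' _ hu, ?_⟩
    rw [← Module.End.mul_apply, ← pow_add, hDv, h]
    congr 2
    omega
  have hDn : IsNilpotent D := by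
    refine isNilpotent_projection_mul hXZ hXn hZn hWU hXU hXW fun w hw => ?_
    obtain ⟨u, -, h⟩ := hlift (Nat.zero_le r) (hXr hw)
    rw [← hπdef, ← hDv, h, pow_succ']
    exact ⟨_, rfl⟩
  have hbot : wordFiltration X D W r = ⊥ := wordFiltration_eq_bot hXD hXn hDn hXW hDW hr
  have hWk (k : ℕ) : wordFiltration X D W k ≤ W := wordFiltration_le hXW hDW k
  -- `Z` and `X` shift the filtration `X ^ (k + 1) U + (X, D) ^ k W`.
  let G (k : ℕ) : Submodule F V := U.map (X ^ (k + 1)) ⊔ wordFiltration X D W k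
  have hmem {k : ℕ} {u : V} (hu : u ∈ U) : (X ^ (k + 1)) u ∈ G k :=
    Submodule.mem_sup_left (Submodule.mem_map_of_mem hu)
  have hG {k : ℕ} {C : Module.End F V} {T : Submodule F V}
      (h1 : ∀ u ∈ U, C ((X ^ (k + 1)) u) ∈ T)
      (h2 : ∀ w ∈ wordFiltration X D W k, C w ∈ T) : ∀ v ∈ G k, C v ∈ T := by
    intro v hv
    obtain ⟨_, ⟨u, hu, rfl⟩, w, hw, rfl⟩ := Submodule.mem_sup.1 hv
    rw [map_add]
    exact add_mem (h1 u hu) (h2 w hw)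
  have hGX (k : ℕ) : ∀ v ∈ G k, X v ∈ G (k + 1) := by
    refine hG (fun u hu => ?_) fun w hw =>
      Submodule.mem_sup_right (apply_left_mem_wordFiltration hw)
    rw [← Module.End.mul_apply, ← pow_succ']
    exact hmem hu
  have hGZ {k : ℕ} (hk : k ≤ r) : ∀ v ∈ G k, Z v ∈ G (k + 1) := by
    refine hG (fun u hu => ?_) fun w hw => ?_
    · rw [← happ _ _ (hXZ.pow_left _)]
      refine Submodule.mem_sup_right ?_
      simpa using pow_apply_mem_wordFiltration (A := X) (B := D) (k := 0) (hZU u hu) (k + 1)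
    · have h := pow_apply_mem_wordFiltration hw (r - k)
      rw [Nat.add_sub_cancel' hk, hbot, Submodule.mem_bot] at h
      obtain ⟨u, hu, h⟩ := hlift hk h
      rw [← sub_add_cancel (Z w) (D w), h]
      exact add_mem (hmem hu) (Submodule.mem_sup_right (apply_right_mem_wordFiltration hw))
  have hZ0 (v : V) : Z v ∈ G 0 := by
    obtain ⟨w, hw, u, hu, rfl⟩ :=
      Submodule.mem_sup.1 (hWU.sup_eq_top ▸ Submodule.mem_top : v ∈ W ⊔ U)
    obtain ⟨u', hu', h⟩ := hlift (Nat.zero_le r) (hXr hw)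
    rw [map_add, ← sub_add_cancel (Z w) (D w), h, pow_succ, Module.End.mul_apply]
    refine add_mem (add_mem (hmem (hXU (Submodule.mem_map_of_mem hu'))) ?_)
      (Submodule.mem_sup_right (hZU u hu))
    exact Submodule.mem_sup_right (hDW (Submodule.mem_map_of_mem hw))
  have hZG (a : ℕ) (v : V) : ∀ b : ℕ, a + b ≤ r → (X ^ a) ((Z ^ b) (Z v)) ∈ G (a + b) := by
    induction a with
    | zero =>
      intro b hb
      induction b with
      | zero => simpa using hZ0 v
      | succ b ih =>
        have := hGZ (by omega) _ (ih (by omega))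
        simpa [pow_succ', add_assoc] using this
    | succ a ih =>
      intro b hb
      have := hGX _ _ (ih b (by omega))
      rw [pow_succ', Module.End.mul_apply, add_right_comm]
      exact this
  have hX1 : X ^ (r + 1) * Z = 0 := by
    refine LinearMap.ext fun v => ?_
    obtain ⟨w, hw, u, hu, rfl⟩ :=
      Submodule.mem_sup.1 (hWU.sup_eq_top ▸ Submodule.mem_top : v ∈ W ⊔ U)
    rw [Module.End.mul_apply, map_add, map_add, pow_succ', Module.End.mul_apply,
      Module.End.mul_apply, hXr (hZU u hu), happ _ _ (hXZ.pow_left r), hXr hw]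
    simp
  have hmain {a b : ℕ} (hab : a + b = r) : X ^ a * Z ^ (b + 2) = 0 := by
    refine LinearMap.ext fun v => ?_
    have h := hZG a v b hab.le
    rw [hab] at h
    have h0 : ∀ v ∈ G r, Z v ∈ (⊥ : Submodule F V) := by
      refine hG (fun u hu => ?_) fun w hw => ?_
      · rw [← happ _ _ (hXZ.pow_left _), pow_succ', Module.End.mul_apply, hXr (hZU u hu)]
        simp
      · rw [hbot, Submodule.mem_bot] at hw
        simp [hw]
    have h' := h0 _ h
    rw [Submodule.mem_bot, ← happ _ _ (hXZ.pow_left _)] at h'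
    rw [pow_succ', pow_succ]
    exact h'
  obtain rfl | hj2 : j = 1 ∨ 2 ≤ j := by omega
  · obtain ⟨c, rfl⟩ := Nat.exists_eq_add_of_le (show r + 1 ≤ i by omega)
    rw [add_comm, pow_add, mul_assoc, pow_one, hX1, mul_zero]
  · obtain ⟨b, rfl⟩ := Nat.exists_eq_add_of_le' hj2
    by_cases hb : b ≤ r
    · obtain ⟨c, rfl⟩ := Nat.exists_eq_add_of_le (show r - b ≤ i by omega)
      rw [add_comm, pow_add, mul_assoc, hmain (by omega), mul_zero]
    · obtain ⟨c, rfl⟩ := Nat.exists_eq_add_of_le (show r ≤ b by omega)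
      have := hmain (Nat.zero_add r)
      rw [pow_zero, one_mul] at this
      rw [add_right_comm, pow_add Z, this, zero_mul, mul_zero]

end Complement

section Cyclic

variable {X Y : Module.End F V} {m r : ℕ}

/-- The `X`-stable subspace generated by `e`. -/
noncomputable def cyclicSubspace (X : Module.End F V) (e : V) : Submodule F V :=
  LinearMap.range (LinearMap.applyₗ e ∘ₗ (aeval X : F[X] →ₐ[F] Module.End F V).toLinearMap)

theorem mem_cyclicSubspace {e v : V} : v ∈ cyclicSubspace X e ↔ ∃ p : F[X], aeval X p e = v :=
  Iff.rfl

/-- The largest `X`-stable subspace on which `φ` vanishes, if `X ^ m = 0`. -/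
def dualAnnihilatorSubspace (X : Module.End F V) (φ : Module.Dual F V) (m : ℕ) :
    Submodule F V :=
  LinearMap.ker (LinearMap.pi fun i : Fin m => φ ∘ₗ (X ^ (i : ℕ)))

theorem mem_dualAnnihilatorSubspace {φ : Module.Dual F V} {v : V} :
    v ∈ dualAnnihilatorSubspace X φ m ↔ ∀ i < m, φ ((X ^ i) v) = 0 := by
  simp [dualAnnihilatorSubspace, LinearMap.mem_ker, funext_iff, Fin.forall_iff]

theorem map_cyclicSubspace_le (e : V) :
    (cyclicSubspace X e).map X ≤ cyclicSubspace X e := by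
  rintro _ ⟨_, ⟨p, rfl⟩, rfl⟩
  exact ⟨Polynomial.X * p, by simp⟩

theorem map_dualAnnihilatorSubspace_le (hX : X ^ m = 0) (φ : Module.Dual F V) :
    (dualAnnihilatorSubspace X φ m).map X ≤ dualAnnihilatorSubspace X φ m := by
  rintro _ ⟨v, hv, rfl⟩
  rw [SetLike.mem_coe, mem_dualAnnihilatorSubspace] at hv
  rw [mem_dualAnnihilatorSubspace]
  intro i hi
  rw [← Module.End.mul_apply, ← pow_succ]
  rcases Nat.lt_or_ge (i + 1) m with h | h
  · exact hv _ h
  · rw [pow_eq_zero_of_le h hX]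
    simp

theorem aeval_eq_zero_of_X_pow_dvd (hX : X ^ m = 0) {p : F[X]} (hp : Polynomial.X ^ m ∣ p) :
    aeval X p = 0 := by
  obtain ⟨q, rfl⟩ := hp
  simp [hX]

theorem le_finrank_cyclicSubspace [FiniteDimensional F V] (hX : X ^ m = 0) {e : V}
    {φ : Module.Dual F V} (hφ : φ ((X ^ (m - 1)) e) ≠ 0) :
    m ≤ Module.finrank F (cyclicSubspace X e) := by
  let f : degreeLT F m →ₗ[F] V :=
    (LinearMap.applyₗ e ∘ₗ (aeval X : F[X] →ₐ[F] Module.End F V).toLinearMap).domRestrict _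
  have hf : Function.Injective f := by
    rw [← LinearMap.ker_eq_bot, LinearMap.ker_eq_bot']
    rintro ⟨p, hp⟩ h
    have h0 : aeval X p e = 0 := h
    have hdvd : Polynomial.X ^ m ∣ p :=
      X_pow_dvd_of_forall_apply_eq_zero hX φ hφ fun i _ => by simp [h0]
    rw [mem_degreeLT] at hp
    exact Subtype.ext (eq_zero_of_dvd_of_degree_lt hdvd (by simpa using hp))
  calc m = Module.finrank F (degreeLT F m) := by
        rw [(degreeLTEquiv F m).finrank_eq, Module.finrank_fin_fun]
    _ = Module.finrank F (LinearMap.range f) := (LinearMap.finrank_range_of_inj hf).symm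
    _ ≤ _ := by
        refine Submodule.finrank_mono ?_
        rintro _ ⟨p, rfl⟩
        exact ⟨p, rfl⟩

theorem finrank_le_add_finrank_dualAnnihilatorSubspace [FiniteDimensional F V]
    (X : Module.End F V) (φ : Module.Dual F V) (m : ℕ) :
    Module.finrank F V ≤ m + Module.finrank F (dualAnnihilatorSubspace X φ m) := by
  let f : V →ₗ[F] Fin m → F := LinearMap.pi fun i : Fin m => φ ∘ₗ (X ^ (i : ℕ))
  have h : Module.finrank F (LinearMap.range f) ≤ m := by
    simpa using Submodule.finrank_le (LinearMap.range f)
  rw [← LinearMap.finrank_range_add_finrank_ker f]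
  exact Nat.add_le_add_right h _

theorem isCompl_dualAnnihilatorSubspace [FiniteDimensional F V] (hX : X ^ m = 0) {e : V}
    {φ : Module.Dual F V} (hφ : φ ((X ^ (m - 1)) e) ≠ 0) :
    IsCompl (dualAnnihilatorSubspace X φ m) (cyclicSubspace X e) := by
  have hdisj : Disjoint (dualAnnihilatorSubspace X φ m) (cyclicSubspace X e) := by
    rw [Submodule.disjoint_def]
    rintro _ h ⟨p, rfl⟩
    have hdvd := X_pow_dvd_of_forall_apply_eq_zero hX φ hφ (mem_dualAnnihilatorSubspace.1 h)
    change aeval X p e = 0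
    rw [aeval_eq_zero_of_X_pow_dvd hX hdvd, LinearMap.zero_apply]
  refine ⟨hdisj, codisjoint_iff.2 (Submodule.eq_top_of_disjoint _ _ ?_ hdisj)⟩
  have h1 := finrank_le_add_finrank_dualAnnihilatorSubspace X φ m
  have h2 := le_finrank_cyclicSubspace hX hφ
  omega

theorem exists_eq_pow_apply_of_mem_cyclicSubspace (hX : X ^ m = 0) {e : V}
    {φ : Module.Dual F V} (hφ : φ ((X ^ (m - 1)) e) ≠ 0) {u : V} (hu : u ∈ cyclicSubspace X e)
    {j : ℕ} (hj : j ≤ m) (h : (X ^ j) u = 0) :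
    ∃ u' ∈ cyclicSubspace X e, u = (X ^ (m - j)) u' := by
  obtain ⟨p, rfl⟩ := mem_cyclicSubspace.1 hu
  have hdvd : Polynomial.X ^ m ∣ Polynomial.X ^ j * p :=
    X_pow_dvd_of_forall_apply_eq_zero hX φ hφ fun i _ => by simp [h]
  rw [← Nat.add_sub_cancel' hj, pow_add] at hdvd
  obtain ⟨q, rfl⟩ := (mul_dvd_mul_iff_left (pow_ne_zero j X_ne_zero)).1 hdvd
  exact ⟨_, mem_cyclicSubspace.2 ⟨q, rfl⟩, by simp⟩

theorem exists_dual_apply_ne_zero {A : Module.End F V} (hA : A ≠ 0) :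
    ∃ (e : V) (φ : Module.Dual F V), φ (A e) ≠ 0 := by
  by_contra! h
  exact hA (LinearMap.ext fun e => (Module.forall_dual_apply_eq_zero_iff F _).1 (h e))

theorem finrank_dualAnnihilatorSubspace_le [FiniteDimensional F V] (hX : X ^ m = 0) {e : V}
    {φ : Module.Dual F V} (hφ : φ ((X ^ (m - 1)) e) ≠ 0) (hr : Module.finrank F V = m + r) :
    Module.finrank F (dualAnnihilatorSubspace X φ m) ≤ r := by
  have h1 := Submodule.finrank_add_eq_of_isCompl (isCompl_dualAnnihilatorSubspace hX hφ)
  have h2 := le_finrank_cyclicSubspace hX hφ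
  omega

theorem commute_aeval (h : Commute Y X) (s : F[X]) : Commute Y (aeval X s) := by
  induction s using Polynomial.induction_on' with
  | add p q hp hq => simpa using hp.add_right hq
  | monomial n a =>
    rw [aeval_monomial]
    exact Commute.mul_right (Algebra.commutes a Y).symm (h.pow_right n)

/-- If `X` has a Jordan block of size `m` and `X`-stable complement of dimension `r ≤ m - 2`, then
the high powers of a nilpotent `Y` commuting with `X` are those of a polynomial in `X`. -/
theorem exists_pow_eq_aeval_mul_pow [FiniteDimensional F V] (hXY : Commute X Y)
    (hYn : IsNilpotent Y) (hX : X ^ m = 0) (hX' : X ^ (m - 1) ≠ 0)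
    (hr : Module.finrank F V = m + r) (hrm : r + 2 ≤ m) :
    ∃ q : F[X], ∀ k, r + 2 ≤ k → Y ^ k = (aeval X (Polynomial.X * q)) ^ k := by
  have hXn : IsNilpotent X := ⟨m, hX⟩
  obtain ⟨e, φ, hφ⟩ := exists_dual_apply_ne_zero hX'
  have he : (X ^ (m - 1)) e ≠ 0 := fun h => hφ (by rw [h, map_zero])
  have hWU := isCompl_dualAnnihilatorSubspace hX hφ
  have hXW := map_dualAnnihilatorSubspace_le hX φ
  have hXU := map_cyclicSubspace_le (X := X) e
  have hWr := finrank_dualAnnihilatorSubspace_le hX hφ hr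
  have hU := fun u hu j hj => exists_eq_pow_apply_of_mem_cyclicSubspace hX hφ (u := u) hu (j := j) hj
  set U := cyclicSubspace X e
  set W := dualAnnihilatorSubspace X φ m
  obtain ⟨w, hw, u, hu, hYe⟩ :=
    Submodule.mem_sup.1 (hWU.sup_eq_top ▸ Submodule.mem_top : Y e ∈ W ⊔ U)
  obtain ⟨p, rfl⟩ := mem_cyclicSubspace.1 hu
  have hp0 : p.coeff 0 = 0 := by
    have hYs : Y ((X ^ (m - 1)) e) = p.coeff 0 • (X ^ (m - 1)) e := by
      have h1 : (X ^ (m - 1)) w = 0 := by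
        rw [show m - 1 = (m - 1 - r) + r by omega, pow_add, Module.End.mul_apply,
          pow_apply_eq_zero_of_finrank_le hXn hXW hWr hw, map_zero]
      have h2 := pow_apply_aeval_of_coeff_eq_zero hX (p := p) (a := 0) (by omega) (by simp) e
      rw [← Module.End.mul_apply, ← (hXY.pow_left (m - 1)).eq, Module.End.mul_apply, ← hYe, map_add,
        h1, zero_add, ← h2, Nat.sub_zero]
    have hYk (k : ℕ) : (Y ^ k) ((X ^ (m - 1)) e) = p.coeff 0 ^ k • (X ^ (m - 1)) e := by
      induction k with
      | zero => simp
      | succ k ih => rw [pow_succ, Module.End.mul_apply, hYs, map_smul, ih, smul_smul, pow_succ']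
    obtain ⟨N, hN⟩ := hYn
    have := hYk N
    rw [hN, LinearMap.zero_apply, eq_comm, smul_eq_zero] at this
    exact eq_zero_of_pow_eq_zero (this.resolve_right he)
  obtain ⟨q, rfl⟩ := X_dvd_iff.2 hp0
  refine ⟨q, fun k hk => ?_⟩
  set P := aeval X (Polynomial.X * q) with hP
  have hPX : P = aeval X q * X := by rw [hP, mul_comm, map_mul, aeval_X]
  have hXq : Commute X (aeval X q) := by
    simpa using (Commute.all Polynomial.X q).map (aeval X : F[X] →ₐ[F] Module.End F V)
  have hYaeval (s : F[X]) : Commute Y (aeval X s) := commute_aeval hXY.symm s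
  have hPn : IsNilpotent P := hPX ▸ hXq.symm.isNilpotent_mul_left hXn
  have hXP : Commute X P := by rw [hPX]; exact hXq.mul_right (Commute.refl X)
  have hYP : Commute Y P := hYaeval _
  have hXZ : Commute X (Y - P) := hXY.sub_right hXP
  have hZe : (Y - P) e ∈ W := by
    rw [LinearMap.sub_apply, ← hYe, add_sub_cancel_right]
    exact hw
  have hZU : ∀ u ∈ U, (Y - P) u ∈ W := by
    rintro _ ⟨s, rfl⟩
    change (Y - P) (aeval X s e) ∈ W
    rw [← Module.End.mul_apply, (commute_aeval hXZ.symm s).eq]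
    exact aeval_apply_smul_mem_of_le_comap hZe s X (Submodule.map_le_iff_le_comap.1 hXW)
  have hZ {i j : ℕ} (hj : 1 ≤ j) (hij : r + 2 ≤ i + j) : X ^ i * (Y - P) ^ j = 0 :=
    pow_mul_pow_eq_zero hXZ hXn (hYP.isNilpotent_sub hYn hPn) hWU hXU hXW hWr hrm hU hZU hj hij
  have hPZ : Commute P (Y - P) := hYP.symm.sub_right (Commute.refl P)
  have := hPZ.add_pow k
  rw [add_sub_cancel] at this
  rw [this, Finset.sum_eq_single k]
  · simp
  · intro i hi hik
    rw [Finset.mem_range] at hi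
    rw [hPX, hXq.symm.mul_pow, ← hPX, mul_assoc (aeval X q ^ i), hZ (by omega) (by omega)]
    simp
  · simp

/-- Kernels of powers of a nilpotent `X` of index `m` grow strictly up to `X ^ m`. -/
theorem finrank_ker_pow_add_le [FiniteDimensional F V] (hX : X ^ m = 0) (hX' : X ^ (m - 1) ≠ 0)
    {k : ℕ} (hk : k ≤ m) :
    Module.finrank F (LinearMap.ker (X ^ k)) + (m - k) ≤ Module.finrank F V := by
  induction hk using Nat.decreasingInduction with
  | self => simpa using Submodule.finrank_le _
  | of_succ k hk ih =>
    have hle : LinearMap.ker (X ^ k) ≤ LinearMap.ker (X ^ (k + 1)) := by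
      rw [pow_succ']
      exact LinearMap.ker_le_ker_comp _ _
    have hne : LinearMap.ker (X ^ k) ≠ LinearMap.ker (X ^ (k + 1)) := by
      intro h
      refine hX' (LinearMap.ext fun v => ?_)
      have hv : (X ^ (m - 1 - k)) v ∈ LinearMap.ker (X ^ (k + 1)) := by
        rw [LinearMap.mem_ker, ← Module.End.mul_apply, ← pow_add,
          show k + 1 + (m - 1 - k) = m by omega, hX, LinearMap.zero_apply]
      rw [← h, LinearMap.mem_ker, ← Module.End.mul_apply, ← pow_add,
        show k + (m - 1 - k) = m - 1 by omega] at hv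
      exact hv
    have := Submodule.finrank_lt_finrank_of_lt (lt_of_le_of_ne hle hne)
    omega

theorem le_finrank_ker_pow [FiniteDimensional F V] (hX : X ^ m = 0) (hX' : X ^ (m - 1) ≠ 0)
    {k : ℕ} (hr : Module.finrank F V = m + r) (hrk : r ≤ k) (hk : k ≤ m) :
    r + k ≤ Module.finrank F (LinearMap.ker (X ^ k)) := by
  obtain ⟨e, φ, hφ⟩ := exists_dual_apply_ne_zero hX'
  have hWU := isCompl_dualAnnihilatorSubspace hX hφ
  have hWr := finrank_dualAnnihilatorSubspace_le hX hφ hr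
  have hdisj : Disjoint (LinearMap.range (X ^ k)) (dualAnnihilatorSubspace X φ (m - k)) := by
    rw [Submodule.disjoint_def]
    rintro _ ⟨v, rfl⟩ hv
    obtain ⟨w, hw, u, hu, rfl⟩ := Submodule.mem_sup.1 (hWU.sup_eq_top ▸ Submodule.mem_top :
      v ∈ dualAnnihilatorSubspace X φ m ⊔ cyclicSubspace X e)
    obtain ⟨p, rfl⟩ := mem_cyclicSubspace.1 hu
    have hw0 : (X ^ k) w = 0 := pow_apply_eq_zero_of_finrank_le ⟨m, hX⟩
      (map_dualAnnihilatorSubspace_le hX φ) (hWr.trans hrk) hw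
    rw [map_add, hw0, zero_add] at hv ⊢
    refine (Submodule.disjoint_def.1 hWU.disjoint) _ (mem_dualAnnihilatorSubspace.2 ?_)
      (mem_cyclicSubspace.2 ⟨Polynomial.X ^ k * p, by simp⟩)
    intro i hi
    rcases Nat.lt_or_ge i (m - k) with h | h
    · exact mem_dualAnnihilatorSubspace.1 hv i h
    · rw [← Module.End.mul_apply, ← pow_add, pow_eq_zero_of_le (by omega) hX]
      simp
  have h1 := Submodule.finrank_add_finrank_le_of_disjoint hdisj
  have h2 := finrank_le_add_finrank_dualAnnihilatorSubspace X φ (m - k)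
  have h3 := LinearMap.finrank_range_add_finrank_ker (X ^ k)
  omega

end Cyclic

end


/-- Corollary 2.5: if `X`, `Y` are commuting nilpotent endomorphisms of an
`n`-dimensional space over an algebraically closed field and `m = h(X) ≥ n/2 + 1`
(i.e. `2m ≥ n + 2`), then every Jordan block size `l` of `Y` with `l > n - m + 2`
(i.e. `l + m > n + 2`) and `l > ⌈m/2⌉` (i.e. `2l > m + 1`) equals `m`.
Here "`Y` has a Jordan block of size `l`" is expressed via kernel dimensions:
`dim Ker(Y^l) - dim Ker(Y^(l-1)) > dim Ker(Y^(l+1)) - dim Ker(Y^l)`. -/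
theorem stmt9 (F : Type*) [Field F] [IsAlgClosed F]
    (V : Type*) [AddCommGroup V] [Module F V] [FiniteDimensional F V]
    (n : ℕ) (hn : n = Module.finrank F V)
    (X Y : V →ₗ[F] V) (hc : Commute X Y) (hYnil : IsNilpotent Y)
    (m : ℕ) (hm1 : 1 ≤ m) (hmX : X ^ m = 0) (hmX' : m = 1 ∨ X ^ (m - 1) ≠ 0)
    (hm : 2 * m ≥ n + 2) :
    ∀ l : ℕ,
      2 * Module.finrank F (LinearMap.ker (Y ^ l)) >
        Module.finrank F (LinearMap.ker (Y ^ (l + 1)))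
          + Module.finrank F (LinearMap.ker (Y ^ (l - 1))) →
      l + m > n + 2 → 2 * l > m + 1 → l = m := by
  intro l hl hlm hlm2
  have hle (k : ℕ) : Module.finrank F (LinearMap.ker (Y ^ k)) ≤ n := hn ▸ Submodule.finrank_le _
  have hX' : X ^ (m - 1) ≠ 0 := by
    refine hmX'.resolve_left ?_
    rintro rfl
    have := hle l
    omega
  have hmn : m ≤ n := by
    have := finrank_ker_pow_add_le hmX hX' (Nat.zero_le m)
    omega
  obtain ⟨r, rfl⟩ := Nat.exists_eq_add_of_le hmn
  obtain ⟨q, hq⟩ := exists_pow_eq_aeval_mul_pow hc hYnil hmX hX' hn.symm (by omega)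
  set Q := aeval X q with hQ
  have hXQ : Commute X Q := commute_aeval (Commute.refl X) q
  have hPow (k : ℕ) (hk : r + 2 ≤ k) : Y ^ k = Q ^ k * X ^ k := by
    rw [hq k hk, map_mul, aeval_X, hXQ.mul_pow, (hXQ.pow_pow k k).eq]
  by_contra hne
  have hnz : Y ^ (l - 1) ≠ 0 := by
    intro h0
    have h1 : Y ^ l = 0 := pow_eq_zero_of_le (Nat.sub_le l 1) h0
    have h2 : Y ^ (l + 1) = 0 := pow_eq_zero_of_le (by omega) h0
    rw [h0, h1, h2] at hl
    omega
  have hlt : l < m := by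
    by_contra h
    exact hnz (by rw [hPow _ (by omega), pow_eq_zero_of_le (by omega) hmX, mul_zero])
  have hq0 : q.coeff 0 ≠ 0 := by
    intro h0
    obtain ⟨s, rfl⟩ := X_dvd_iff.2 h0
    refine hnz ?_
    have hXs : Commute X (aeval X s) := commute_aeval (Commute.refl X) s
    rw [hPow _ (by omega), hQ, map_mul, aeval_X, hXs.mul_pow, (hXs.pow_pow _ _).eq, mul_assoc,
      ← pow_add, pow_eq_zero_of_le (by omega) hmX, mul_zero]
  have hQu : IsUnit Q := by
    have h : Q = algebraMap F _ (q.coeff 0) + aeval X q.divX * X := by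
      conv_lhs => rw [hQ, ← divX_mul_X_add q]
      simp [add_comm]
    have hXd : Commute (aeval X q.divX) X := (commute_aeval (Commute.refl X) _).symm
    rw [h]
    exact (hXd.isNilpotent_mul_left ⟨m, hmX⟩).isUnit_add_left_of_commute
      ((hq0.isUnit).map _) (Algebra.commutes _ _).symm
  have hker (k : ℕ) (hk : r + 2 ≤ k) : LinearMap.ker (Y ^ k) = LinearMap.ker (X ^ k) := by
    rw [hPow k hk]
    exact LinearMap.ker_comp_of_ker_eq_bot _
      (LinearMap.ker_eq_bot.2 ((Module.End.isUnit_iff _).1 (hQu.pow k)).1)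
  rw [hker l (by omega), hker (l + 1) (by omega), hker (l - 1) (by omega)] at hl
  have h1 := finrank_ker_pow_add_le hmX hX' hlt.le
  have h2 := le_finrank_ker_pow hmX hX' hn.symm (show r ≤ l + 1 by omega) hlt
  have h3 := le_finrank_ker_pow hmX hX' hn.symm (show r ≤ l - 1 by omega) (by omega)
  omega
end

section
/- If m > n/2 and X, Y are commuting nilpotent endomorphisms of an n-dimensional vector space with X^m = Y^m = 0, then Z^m = 0 for every Z in the linear span of X and Y. -/
section CommutingPair

variable {F V : Type*} [Field F] [AddCommGroup V] [Module F V]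

/-- The filtration `(X, Y)^i V` of `V` by powers of the ideal generated by `X` and `Y`. -/
def pairFiltration (X Y : V →ₗ[F] V) : ℕ → Submodule F V
  | 0 => ⊤
  | i + 1 => (pairFiltration X Y i).map X ⊔ (pairFiltration X Y i).map Y

namespace pairFiltration

variable {X Y : V →ₗ[F] V} {i j m : ℕ} {v w : V}

lemma apply_left_mem (h : v ∈ pairFiltration X Y i) : X v ∈ pairFiltration X Y (i + 1) :=
  Submodule.mem_sup_left (Submodule.mem_map_of_mem h)

lemma apply_right_mem (h : v ∈ pairFiltration X Y i) : Y v ∈ pairFiltration X Y (i + 1) :=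
  Submodule.mem_sup_right (Submodule.mem_map_of_mem h)

lemma succ_le_iff {S : Submodule F V} : pairFiltration X Y (i + 1) ≤ S ↔
    ∀ v ∈ pairFiltration X Y i, X v ∈ S ∧ Y v ∈ S := by
  simp only [pairFiltration, sup_le_iff, Submodule.map_le_iff_le_comap]
  exact ⟨fun h v hv => ⟨h.1 hv, h.2 hv⟩, fun h => ⟨fun v hv => (h v hv).1, fun v hv => (h v hv).2⟩⟩

lemma swap (X Y : V →ₗ[F] V) (i : ℕ) : pairFiltration X Y i = pairFiltration Y X i := by
  induction i with
  | zero => rfl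
  | succ i ih => simp only [pairFiltration, ih, sup_comm]

lemma succ_le_succ (h : pairFiltration X Y i ≤ pairFiltration X Y j) :
    pairFiltration X Y (i + 1) ≤ pairFiltration X Y (j + 1) :=
  succ_le_iff.2 fun _ hv => ⟨apply_left_mem (h hv), apply_right_mem (h hv)⟩

lemma succ_le (X Y : V →ₗ[F] V) (i : ℕ) :
    pairFiltration X Y (i + 1) ≤ pairFiltration X Y i := by
  induction i with
  | zero => exact le_top
  | succ i ih => exact succ_le_succ ih

lemma antitone (X Y : V →ₗ[F] V) : Antitone (pairFiltration X Y) :=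
  antitone_nat_of_succ_le (succ_le X Y)

lemma monomial_mem (X Y : V →ₗ[F] V) (a b : ℕ) (v : V) :
    (X ^ a) ((Y ^ b) v) ∈ pairFiltration X Y (a + b) := by
  induction a with
  | zero =>
    rw [Nat.zero_add, pow_zero, Module.End.one_apply]
    induction b with
    | zero => trivial
    | succ b ih => rw [pow_succ', Module.End.mul_apply]; exact apply_right_mem ih
  | succ a ih =>
    rw [pow_succ', Module.End.mul_apply, Nat.add_right_comm]
    exact apply_left_mem ih

lemma apply_pow_comm (hc : Commute X Y) (a : ℕ) (v : V) : Y ((X ^ a) v) = (X ^ a) (Y v) :=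
  (LinearMap.congr_fun (hc.pow_left a).eq v).symm

lemma apply_monomial (hc : Commute X Y) (a b : ℕ) (v : V) :
    Y ((X ^ a) ((Y ^ b) v)) = (X ^ a) ((Y ^ (b + 1)) v) := by
  rw [apply_pow_comm hc, pow_succ', Module.End.mul_apply]

lemma le_of_monomial_mem (hc : Commute X Y) {S : Submodule F V}
    (h : ∀ a b v, a + b = i → (X ^ a) ((Y ^ b) v) ∈ S) : pairFiltration X Y i ≤ S := by
  induction i generalizing S with
  | zero => exact fun v _ => h 0 0 v rfl
  | succ i ih =>
    refine sup_le (Submodule.map_le_iff_le_comap.2 (ih fun a b v hab => ?_))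
      (Submodule.map_le_iff_le_comap.2 (ih fun a b v hab => ?_))
    · rw [Submodule.mem_comap, ← Module.End.mul_apply, ← pow_succ']
      exact h (a + 1) b v (by omega)
    · rw [Submodule.mem_comap, apply_monomial hc]
      exact h a (b + 1) v (by omega)

lemma eq_bot_of_pow_eq_zero (hc : Commute X Y) (hX : X ^ m = 0) (hY : Y ^ m = 0) :
    pairFiltration X Y (2 * m) = ⊥ := by
  refine le_bot_iff.1 (le_of_monomial_mem hc fun a b v hab => ?_)
  rcases le_total m a with h | h
  · simp [pow_eq_zero_of_le h hX]
  · simp [pow_eq_zero_of_le (show m ≤ b by omega) hY]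

lemma eq_bot_of_le_succ (hc : Commute X Y) (hX : X ^ m = 0) (hY : Y ^ m = 0)
    (h : pairFiltration X Y i ≤ pairFiltration X Y (i + 1)) : pairFiltration X Y i = ⊥ := by
  have shift (k : ℕ) : pairFiltration X Y (i + k) ≤ pairFiltration X Y (i + k + 1) := by
    induction k with
    | zero => exact h
    | succ k ih => exact succ_le_succ ih
  have stable (k : ℕ) : pairFiltration X Y i ≤ pairFiltration X Y (i + k) := by
    induction k with
    | zero => exact le_rfl
    | succ k ih => exact ih.trans (shift k)
  rw [← le_bot_iff, ← eq_bot_of_pow_eq_zero hc hX hY]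
  exact (stable (2 * m)).trans (antitone X Y (by omega))

lemma mem_span_singleton_sup {S : Submodule F V} :
    w ∈ F ∙ v ⊔ S ↔ ∃ c : F, ∃ r ∈ S, c • v + r = w := by
  simp [Submodule.mem_sup, Submodule.mem_span_singleton]

/-- If a pure power of `X` spans the layer of degree `i ≥ 1`, pure powers of `X` span all the
later layers. -/
lemma le_span_pow (hc : Commute X Y) (hi : 1 ≤ i) (hij : i ≤ j)
    (h : pairFiltration X Y i ≤ F ∙ (X ^ i) v ⊔ pairFiltration X Y (i + 1)) :
    pairFiltration X Y j ≤ F ∙ (X ^ j) v ⊔ pairFiltration X Y (j + 1) := by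
  induction j, hij using Nat.le_induction with
  | base => exact h
  | succ j hij ih =>
    have left {w : V} (hw : w ∈ pairFiltration X Y j) :
        X w ∈ F ∙ (X ^ (j + 1)) v ⊔ pairFiltration X Y (j + 1 + 1) := by
      obtain ⟨c, r, hr, rfl⟩ := mem_span_singleton_sup.1 (ih hw)
      rw [map_add, map_smul, ← Module.End.mul_apply, ← pow_succ']
      exact mem_span_singleton_sup.2 ⟨c, _, apply_left_mem hr, rfl⟩
    refine succ_le_iff.2 fun w hw => ⟨left hw, ?_⟩
    obtain ⟨c, r, hr, rfl⟩ := mem_span_singleton_sup.1 (ih hw)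
    rw [map_add, map_smul]
    refine add_mem (Submodule.smul_mem _ c ?_) (Submodule.mem_sup_right (apply_right_mem hr))
    obtain ⟨k, rfl⟩ : ∃ k, j = k + 1 := ⟨j - 1, by omega⟩
    rw [apply_pow_comm hc, pow_succ' X k, Module.End.mul_apply]
    exact left (by simpa using monomial_mem X Y k 1 v)

lemma linearCombination_pow_mem (c d : F) (i : ℕ) (v : V) :
    ((c • X + d • Y) ^ i) v ∈ pairFiltration X Y i := by
  induction i with
  | zero => trivial
  | succ i ih =>
    rw [pow_succ', Module.End.mul_apply]
    exact add_mem (Submodule.smul_mem _ c (apply_left_mem ih))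
      (Submodule.smul_mem _ d (apply_right_mem ih))

variable [FiniteDimensional F V]

lemma le_span_sup (hd : Module.finrank F (pairFiltration X Y i) ≤
      Module.finrank F (pairFiltration X Y (i + 1)) + 1)
    (hv : v ∈ pairFiltration X Y i) (hv' : v ∉ pairFiltration X Y (i + 1)) :
    pairFiltration X Y i ≤ F ∙ v ⊔ pairFiltration X Y (i + 1) := by
  have hlt : pairFiltration X Y (i + 1) < F ∙ v ⊔ pairFiltration X Y (i + 1) :=
    lt_of_le_of_ne le_sup_right fun h => hv' <| h ▸
      Submodule.mem_sup_left (Submodule.mem_span_singleton_self v)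
  refine (Submodule.eq_of_le_of_finrank_le (sup_le ?_ (succ_le X Y i)) ?_).ge
  · simpa using hv
  · exact hd.trans (Submodule.finrank_lt_finrank_of_lt hlt)

/-- A pure power of `X` that is nonzero in a one-dimensional layer forces vanishing in the
degree in which `X` vanishes. -/
lemma eq_bot_of_pow_notMem (hc : Commute X Y) (hX : X ^ m = 0) (hY : Y ^ m = 0)
    (hi : 1 ≤ i) (him : i ≤ m)
    (hd : Module.finrank F (pairFiltration X Y i) ≤
      Module.finrank F (pairFiltration X Y (i + 1)) + 1)
    (hv : (X ^ i) v ∉ pairFiltration X Y (i + 1)) : pairFiltration X Y m = ⊥ := by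
  have hmem : (X ^ i) v ∈ pairFiltration X Y i := by simpa using monomial_mem X Y i 0 v
  have h := le_span_pow hc hi him (le_span_sup hd hmem hv)
  exact eq_bot_of_le_succ hc hX hY (by simpa [hX] using h)

lemma eq_bot_of_finrank_le (hc : Commute X Y) (hX : X ^ m = 0) (hY : Y ^ m = 0)
    (hi : 1 ≤ i) (him : i < m)
    (hd : Module.finrank F (pairFiltration X Y i) ≤
      Module.finrank F (pairFiltration X Y (i + 1)) + 1) : pairFiltration X Y m = ⊥ := by
  by_contra hne
  have pureX (v : V) : (X ^ i) v ∈ pairFiltration X Y (i + 1) := by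
    by_contra hv
    exact hne (eq_bot_of_pow_notMem hc hX hY hi him.le hd hv)
  have pureY (v : V) : (Y ^ i) v ∈ pairFiltration X Y (i + 1) := by
    by_contra hv
    rw [swap X Y] at hne hv
    rw [swap X Y i, swap X Y (i + 1)] at hd
    exact hne (eq_bot_of_pow_notMem hc.symm hY hX hi him.le hd hv)
  have eq_bot {k : ℕ} (hk : k ≤ m)
      (h : pairFiltration X Y k ≤ pairFiltration X Y (k + 1)) : False :=
    hne <| le_bot_iff.1 <| (antitone X Y hk).trans (eq_bot_of_le_succ hc hX hY h).le
  refine eq_bot him.le (le_of_monomial_mem hc fun a => ?_)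
  induction a with
  | zero =>
    rintro b v hb
    obtain rfl : b = i := by omega
    simpa using pureY v
  | succ a ih =>
    rintro (_ | b) v hab
    · obtain rfl : a + 1 = i := by omega
      simpa using pureX v
    by_contra hu
    have hspan := le_span_sup hd (hab ▸ monomial_mem X Y (a + 1) (b + 1) v) hu
    have hYu : Y ((X ^ (a + 1)) ((Y ^ (b + 1)) v)) ∈ pairFiltration X Y (i + 1 + 1) := by
      rw [apply_monomial hc, pow_succ' X, Module.End.mul_apply]
      exact apply_left_mem (ih (b + 1 + 1) v (by omega))
    have hXu : X ((X ^ (a + 1)) ((Y ^ (b + 1)) v)) ∈ pairFiltration X Y (i + 1 + 1) := by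
      have hmem : (X ^ (a + 1 + 1)) ((Y ^ b) v) ∈ pairFiltration X Y i := by
        have := monomial_mem X Y (a + 1 + 1) b v
        rwa [show a + 1 + 1 + b = i by omega] at this
      obtain ⟨d, r, hr, h⟩ := mem_span_singleton_sup.1 (hspan hmem)
      rw [← Module.End.mul_apply, ← pow_succ', ← apply_monomial hc, ← h, map_add, map_smul]
      exact add_mem (Submodule.smul_mem _ d hYu) (apply_right_mem hr)
    refine eq_bot him (succ_le_iff.2 fun w hw => ?_)
    obtain ⟨c, r, hr, rfl⟩ := mem_span_singleton_sup.1 (hspan hw)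
    simp only [map_add, map_smul]
    exact ⟨add_mem (Submodule.smul_mem _ c hXu) (apply_left_mem hr),
      add_mem (Submodule.smul_mem _ c hYu) (apply_right_mem hr)⟩

lemma eq_bot_of_finrank_lt (hc : Commute X Y) (hX : X ^ m = 0) (hY : Y ^ m = 0)
    (hm0 : 1 ≤ m) (hm : Module.finrank F V < 2 * m) : pairFiltration X Y m = ⊥ := by
  by_contra hne
  have drop (k : ℕ) (hk : k + 1 ≤ m) :
      Module.finrank F (pairFiltration X Y (k + 1)) + 2 * k + 1 ≤ Module.finrank F V := by
    induction k with
    | zero =>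
      refine Submodule.finrank_lt fun h => hne <| le_bot_iff.1 ?_
      exact (antitone X Y (Nat.zero_le m)).trans (eq_bot_of_le_succ hc hX hY (h ▸ le_top)).le
    | succ k ih =>
      have := ih (by omega)
      by_contra hlt
      exact hne (eq_bot_of_finrank_le hc hX hY (Nat.le_add_left 1 k) hk (by omega))
  have hpos := Submodule.one_le_finrank_iff.2 hne
  obtain ⟨k, rfl⟩ : ∃ k, m = k + 1 := ⟨m - 1, by omega⟩
  have := drop k le_rfl
  omega

end pairFiltration

end CommutingPair

/-- Corollary 2.6: if `2m > n` and `X`, `Y` are commuting nilpotent endomorphisms of an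
`n`-dimensional space with `X^m = Y^m = 0`, then `Z^m = 0` for every `Z = aX + bY`
in the linear span of `X` and `Y` (Corollary 2.6). -/
theorem stmt11 (F : Type*) [Field F]
    (V : Type*) [AddCommGroup V] [Module F V] [FiniteDimensional F V]
    (n : ℕ) (hn : n = Module.finrank F V)
    (m : ℕ) (hm0 : 1 ≤ m) (hm : 2 * m > n)
    (X Y : V →ₗ[F] V) (hc : Commute X Y)
    (hX : X ^ m = 0) (hY : Y ^ m = 0) :
    ∀ a b : F, (a • X + b • Y) ^ m = 0 := by
  intro a b
  subst hn
  ext v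
  have h := pairFiltration.linearCombination_pow_mem (X := X) (Y := Y) a b m v
  rwa [pairFiltration.eq_bot_of_finrank_lt hc hX hY hm0 hm, Submodule.mem_bot] at h
end
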